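/- arXiv:1406.6712 — 2 statements merged into one kernel-verified Lean document; each statement's English description precedes it below -/
import Mathlib

section
/- For every 0 < p < 1 and p < q ≤ 2 there exists a constant C_{p,q} > 0 such that for all positive integers N, m with 1 ≤ m < N^2 there is a linear map 𝒜 : M_N → ℝ^m with the following property: with r = min{1, q}, for every X ∈ M_N with ‖X‖_{S_{p,∞}} ≤ 1 and every minimizer X* of ‖Z‖_{S_r} over all Z ∈ M_N with 𝒜Z = 𝒜X, one has ‖X − X*‖_{S_q} ≤ C_{p,q} · min{1, N/m}^{1/p − 1/q}. -/
noncomputable def singVals {N : ℕ} (X : Matrix (Fin N) (Fin N) ℝ) : Fin N → ℝ :=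
  fun i => Real.sqrt ((Matrix.isHermitian_conjTranspose_mul_self X).eigenvalues i)

/-- The Schatten `p`-quasi-norm of a real `N × N` matrix. -/
noncomputable def schattenNorm {N : ℕ} (p : ℝ) (X : Matrix (Fin N) (Fin N) ℝ) : ℝ :=
  (∑ i, singVals X i ^ p) ^ (1 / p)

/-- The singular values of `X` arranged in nonincreasing order:
`sortedSingVals X k` is the `(k+1)`-st largest singular value of `X`. -/
noncomputable def sortedSingVals {N : ℕ} (X : Matrix (Fin N) (Fin N) ℝ) : Fin N → ℝ :=
  fun k => (singVals X ∘ Tuple.sort (singVals X)) k.rev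

/-- The weak Schatten `p`-quasi-norm: `max_{1 ≤ k ≤ N} k^{1/p} σ*_k(X)`. -/
noncomputable def weakSchattenNorm {N : ℕ} (p : ℝ) (X : Matrix (Fin N) (Fin N) ℝ) : ℝ :=
  ⨆ k : Fin N, ((k : ℝ) + 1) ^ (1 / p) * sortedSingVals X k

section DiagIn

open Matrix

/-- The symmetric matrix with eigenvectors the columns of `V` and eigenvalues `f`. -/
noncomputable def diagIn {N : ℕ} (V : Matrix (Fin N) (Fin N) ℝ) (f : Fin N → ℝ) :
    Matrix (Fin N) (Fin N) ℝ :=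
  V * diagonal f * Vᵀ

variable {N : ℕ} {V : Matrix (Fin N) (Fin N) ℝ}

theorem diagIn_transpose (f : Fin N → ℝ) : (diagIn V f)ᵀ = diagIn V f := by
  simp [diagIn, Matrix.mul_assoc]

theorem diagIn_mul (hV : Vᵀ * V = 1) (f g : Fin N → ℝ) :
    diagIn V f * diagIn V g = diagIn V (fun i => f i * g i) := by
  calc V * diagonal f * Vᵀ * (V * diagonal g * Vᵀ)
      = V * diagonal f * (Vᵀ * V) * diagonal g * Vᵀ := by simp only [Matrix.mul_assoc]
    _ = _ := by rw [hV, Matrix.mul_one, Matrix.mul_assoc V, diagonal_mul_diagonal]; rfl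

theorem diagIn_add (f g : Fin N → ℝ) :
    diagIn V f + diagIn V g = diagIn V (fun i => f i + g i) := by
  rw [diagIn, diagIn, diagIn, ← diagonal_add, Matrix.mul_add, Matrix.add_mul]

theorem diagIn_one (hV : Vᵀ * V = 1) : diagIn V (fun _ => 1) = 1 := by
  rw [diagIn, diagonal_one, Matrix.mul_one, mul_eq_one_comm.mp hV]

theorem trace_diagIn (hV : Vᵀ * V = 1) (f : Fin N → ℝ) : (diagIn V f).trace = ∑ i, f i := by
  rw [diagIn, Matrix.trace_mul_comm, ← Matrix.mul_assoc, hV, Matrix.one_mul, trace_diagonal]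

theorem rank_diagIn_le (f : Fin N → ℝ) :
    (diagIn V f).rank ≤ (Finset.univ.filter fun i => f i ≠ 0).card := by
  classical
  refine (rank_mul_le_left _ _).trans ((rank_mul_le_right _ _).trans ?_)
  rw [rank_diagonal, Fintype.card_subtype]

theorem charpoly_diagIn (hV : Vᵀ * V = 1) (f : Fin N → ℝ) :
    (diagIn V f).charpoly = (diagonal f).charpoly := by
  rw [diagIn, charpoly_mul_comm, ← Matrix.mul_assoc, hV, Matrix.one_mul]

end DiagIn

section SingularValues

open Matrix

variable {N : ℕ}

theorem singVals_nonneg (X : Matrix (Fin N) (Fin N) ℝ) (i : Fin N) : 0 ≤ singVals X i :=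
  Real.sqrt_nonneg _

theorem sq_singVals (X : Matrix (Fin N) (Fin N) ℝ) (i : Fin N) :
    singVals X i ^ 2 = (isHermitian_conjTranspose_mul_self X).eigenvalues i :=
  Real.sq_sqrt ((posSemidef_conjTranspose_mul_self X).eigenvalues_nonneg i)

theorem exists_transpose_mul_self_eq_diagIn (X : Matrix (Fin N) (Fin N) ℝ) :
    ∃ V : Matrix (Fin N) (Fin N) ℝ, Vᵀ * V = 1 ∧
      Xᵀ * X = diagIn V (fun i => singVals X i ^ 2) := by
  have h := isHermitian_conjTranspose_mul_self X
  refine ⟨h.eigenvectorUnitary, ?_, ?_⟩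
  · have := Unitary.coe_star_mul_self h.eigenvectorUnitary
    simpa [star_eq_conjTranspose, conjTranspose_eq_transpose_of_trivial] using this
  · have := h.spectral_theorem
    rw [Unitary.conjStarAlgAut_apply] at this
    simp only [sq_singVals, diagIn]
    change _ = _ * diagonal h.eigenvalues * _
    simpa [star_eq_conjTranspose, conjTranspose_eq_transpose_of_trivial] using this

/-- Symmetric functions of the singular values are symmetric functions of the roots of the
characteristic polynomial of the Gram matrix. -/
theorem sum_singVals_eq_sum_roots (X : Matrix (Fin N) (Fin N) ℝ) (φ : ℝ → ℝ) :
    ∑ i, φ (singVals X i) = ((Xᵀ * X).charpoly.roots.map fun t => φ (√t)).sum := by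
  have h := (isHermitian_conjTranspose_mul_self X).roots_charpoly_eq_eigenvalues
  rw [← conjTranspose_eq_transpose_of_trivial, h, Multiset.map_map]
  rfl

theorem sum_singVals_of_gram_eq_diagIn {V : Matrix (Fin N) (Fin N) ℝ} (hV : Vᵀ * V = 1)
    {B : Matrix (Fin N) (Fin N) ℝ} {d : Fin N → ℝ} (hB : Bᵀ * B = diagIn V d) (φ : ℝ → ℝ) :
    ∑ i, φ (singVals B i) = ∑ i, φ (√(d i)) := by
  rw [sum_singVals_eq_sum_roots, hB, charpoly_diagIn hV, charpoly_diagonal,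
    Polynomial.roots_prod]
  · simp [List.sum_ofFn]
  · simp [Finset.prod_ne_zero_iff, Polynomial.X_sub_C_ne_zero]

/-- The nonzero singular values of a sum with orthogonal ranges and coranges. -/
theorem sum_singVals_add_of_orthogonal {A B : Matrix (Fin N) (Fin N) ℝ} (h₁ : Aᵀ * B = 0)
    (h₂ : A * Bᵀ = 0) {φ : ℝ → ℝ} (hφ : φ 0 = 0) :
    ∑ i, φ (singVals (A + B) i) = ∑ i, φ (singVals A i) + ∑ i, φ (singVals B i) := by
  have h₃ : Bᵀ * A = 0 := by rw [← transpose_transpose A, ← transpose_mul, h₁, transpose_zero]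
  have hsum : (A + B)ᵀ * (A + B) = Aᵀ * A + Bᵀ * B := by
    rw [transpose_add, Matrix.add_mul, Matrix.mul_add, Matrix.mul_add, h₁, h₃]
    simp
  have hprod : (Aᵀ * A) * (Bᵀ * B) = 0 := by
    rw [Matrix.mul_assoc, ← Matrix.mul_assoc A, h₂]
    simp
  have hchar : (Aᵀ * A).charpoly * (Bᵀ * B).charpoly =
      Polynomial.X ^ N * (Aᵀ * A + Bᵀ * B).charpoly := by
    generalize Aᵀ * A = P at *
    generalize Bᵀ * B = Q at *
    have hs : Polynomial.X ^ N =
        (scalar (Fin N) (Polynomial.X : Polynomial ℝ)).det := by simp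
    have hpq : Polynomial.C.mapMatrix P * Polynomial.C.mapMatrix Q = 0 := by
      rw [← map_mul, hprod, map_zero]
    rw [charpoly, charpoly, charpoly, hs, ← det_mul, ← det_mul]
    congr 1
    rw [charmatrix, charmatrix, charmatrix, map_add]
    have hc : Polynomial.C.mapMatrix P * scalar (Fin N) (Polynomial.X : Polynomial ℝ) =
        scalar (Fin N) (Polynomial.X : Polynomial ℝ) * Polynomial.C.mapMatrix P :=
      (scalar_commute _ (fun _ => Polynomial.X_mul ) _).symm.eq
    rw [sub_mul, mul_sub, mul_sub, mul_sub, mul_add, hpq, hc]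
    abel
  have hroots := congrArg Polynomial.roots hchar
  rw [Polynomial.roots_mul ((charpoly_monic _).mul (charpoly_monic _)).ne_zero,
    Polynomial.roots_mul ((Polynomial.monic_X_pow N).mul (charpoly_monic _)).ne_zero,
    Polynomial.roots_X_pow] at hroots
  rw [sum_singVals_eq_sum_roots, sum_singVals_eq_sum_roots, sum_singVals_eq_sum_roots, hsum,
    ← Multiset.sum_add, ← Multiset.map_add, hroots]
  simp [Multiset.map_nsmul, Multiset.sum_nsmul, hφ]

theorem sum_sq_singVals (X : Matrix (Fin N) (Fin N) ℝ) :
    ∑ i, singVals X i ^ 2 = (Xᵀ * X).trace := by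
  obtain ⟨V, hV, h⟩ := exists_transpose_mul_self_eq_diagIn X
  rw [h, trace_diagIn hV]

theorem card_singVals_ne_zero (X : Matrix (Fin N) (Fin N) ℝ) :
    (Finset.univ.filter fun i => singVals X i ≠ 0).card = X.rank := by
  rw [← rank_conjTranspose_mul_self,
    (isHermitian_conjTranspose_mul_self X).rank_eq_card_non_zero_eigs, Fintype.card_subtype]
  congr 1
  ext i
  rw [Finset.mem_filter, Finset.mem_filter, ← sq_singVals, ne_eq, ne_eq, sq_eq_zero_iff]

end SingularValues

section Triangle

open Matrix

variable {N : ℕ} {V X : Matrix (Fin N) (Fin N) ℝ}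

theorem diagIn_mulVec_transpose (hV : Vᵀ * V = 1) (d : Fin N → ℝ) (i : Fin N) :
    diagIn V d *ᵥ Vᵀ i = d i • Vᵀ i := by
  have h : diagIn V d * V = V * diagonal d := by
    rw [diagIn, Matrix.mul_assoc, hV, Matrix.mul_one]
  ext a
  have := congrFun (congrFun h a) i
  rw [mul_diagonal] at this
  rw [Pi.smul_apply, transpose_apply, smul_eq_mul, mul_comm, ← this]
  rfl

theorem transpose_dotProduct_self (hV : Vᵀ * V = 1) (i : Fin N) : Vᵀ i ⬝ᵥ Vᵀ i = 1 := by
  have h := congrFun (congrFun hV i) i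
  rwa [one_apply_eq] at h

theorem trace_mul_diagIn (T : Matrix (Fin N) (Fin N) ℝ) (f : Fin N → ℝ) :
    (T * diagIn V f).trace = ∑ i, f i * (Vᵀ i ⬝ᵥ T *ᵥ Vᵀ i) := by
  rw [diagIn, ← Matrix.mul_assoc, Matrix.trace_mul_comm, ← Matrix.mul_assoc, ← Matrix.mul_assoc,
    trace]
  refine Finset.sum_congr rfl fun i _ => ?_
  rw [diag_apply, mul_diagonal, mul_comm, Matrix.mul_assoc]
  rfl

theorem mulVec_dotProduct_mulVec_self (A : Matrix (Fin N) (Fin N) ℝ) (x : Fin N → ℝ) :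
    (A *ᵥ x) ⬝ᵥ (A *ᵥ x) = x ⬝ᵥ (Aᵀ * A) *ᵥ x := by
  rw [← mulVec_mulVec, dotProduct_mulVec x, vecMul_transpose]

theorem mulVec_transpose_dotProduct_self (hV : Vᵀ * V = 1) {d : Fin N → ℝ}
    (hX : Xᵀ * X = diagIn V d) (i : Fin N) : (X *ᵥ Vᵀ i) ⬝ᵥ (X *ᵥ Vᵀ i) = d i := by
  rw [mulVec_dotProduct_mulVec_self, hX, diagIn_mulVec_transpose hV, dotProduct_smul,
    transpose_dotProduct_self hV, smul_eq_mul, mul_one]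

theorem gram_mul_diagIn (hV : Vᵀ * V = 1) {d : Fin N → ℝ} (hX : Xᵀ * X = diagIn V d)
    (f : Fin N → ℝ) :
    (X * diagIn V f)ᵀ * (X * diagIn V f) = diagIn V (fun i => d i * f i ^ 2) := by
  rw [transpose_mul, diagIn_transpose, Matrix.mul_assoc, ← Matrix.mul_assoc Xᵀ, hX, diagIn_mul hV,
    diagIn_mul hV]
  congr 1
  ext i
  ring

theorem mul_diagIn_eq_zero (hV : Vᵀ * V = 1) {d : Fin N → ℝ} (hX : Xᵀ * X = diagIn V d)
    {f : Fin N → ℝ} (hf : ∀ i, d i * f i = 0) : X * diagIn V f = 0 := by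
  have h := gram_mul_diagIn hV hX f
  have h0 : (fun i => d i * f i ^ 2) = fun _ => 0 := by
    ext i
    rw [pow_two, ← mul_assoc, hf, zero_mul]
  have h1 : diagIn V (fun _ => 0) = 0 := by simp [diagIn]
  rw [h0, h1, ← conjTranspose_eq_transpose_of_trivial] at h
  exact conjTranspose_mul_self_eq_zero.mp h

theorem mulVec_dotProduct_of_projection {P : Matrix (Fin N) (Fin N) ℝ} (hs : Pᵀ = P)
    (hP : P * P = P) (x : Fin N → ℝ) : x ⬝ᵥ P *ᵥ x = (P *ᵥ x) ⬝ᵥ (P *ᵥ x) := by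
  rw [mulVec_dotProduct_mulVec_self, hs, hP]

theorem zero_le_dotProduct_self (x : Fin N → ℝ) : 0 ≤ x ⬝ᵥ x :=
  Finset.sum_nonneg fun i _ => mul_self_nonneg (x i)

theorem mulVec_dotProduct_self_le_of_projection {P : Matrix (Fin N) (Fin N) ℝ} (hs : Pᵀ = P)
    (hP : P * P = P) (x : Fin N → ℝ) : (P *ᵥ x) ⬝ᵥ (P *ᵥ x) ≤ x ⬝ᵥ x := by
  have h := zero_le_dotProduct_self (x - P *ᵥ x)
  have h1 := mulVec_dotProduct_of_projection hs hP x
  rw [sub_dotProduct, dotProduct_sub, dotProduct_sub, dotProduct_comm (P *ᵥ x) x, h1] at h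
  linarith

/-- The trace of a contraction against a spectral piece of `X` is at most the sum of the
corresponding singular values. -/
theorem trace_contraction_mul_le (hV : Vᵀ * V = 1)
    (hX : Xᵀ * X = diagIn V (fun i => singVals X i ^ 2)) {K : Matrix (Fin N) (Fin N) ℝ}
    (hK : ∀ x, (K *ᵥ x) ⬝ᵥ (K *ᵥ x) ≤ x ⬝ᵥ x) {f : Fin N → ℝ} (hf : ∀ i, 0 ≤ f i) :
    (K * (X * diagIn V f)).trace ≤ ∑ i, f i * singVals X i := by
  rw [← Matrix.mul_assoc, trace_mul_diagIn]
  refine Finset.sum_le_sum fun i _ => mul_le_mul_of_nonneg_left ?_ (hf i)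
  rw [← mulVec_mulVec]
  have h1 := hK (X *ᵥ Vᵀ i)
  rw [mulVec_transpose_dotProduct_self hV hX] at h1
  have h2 := Finset.sum_mul_sq_le_sq_mul_sq Finset.univ (Vᵀ i) (K *ᵥ X *ᵥ Vᵀ i)
  have h3 := transpose_dotProduct_self hV i
  simp only [dotProduct, ← pow_two] at h1 h3
  rw [h3, one_mul] at h2
  exact (le_abs_self _).trans (abs_le_of_sq_le_sq (h2.trans h1) (singVals_nonneg X i))

theorem rank_add_le_rank_add_rank (A B : Matrix (Fin N) (Fin N) ℝ) :
    (A + B).rank ≤ A.rank + B.rank := by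
  have h : LinearMap.range (A + B).mulVecLin ≤
      LinearMap.range A.mulVecLin ⊔ LinearMap.range B.mulVecLin := by
    rintro _ ⟨x, rfl⟩
    rw [mulVecLin_add]
    exact Submodule.add_mem_sup ⟨x, rfl⟩ ⟨x, rfl⟩
  exact (Submodule.finrank_mono h).trans (Submodule.finrank_add_le_finrank_add_finrank _ _)

theorem sum_min_singVals_add_le (A B : Matrix (Fin N) (Fin N) ℝ) {c : ℝ} (hc : 0 ≤ c) :
    ∑ i, min (singVals (A + B) i) c ≤
      ∑ i, min (singVals A i) c + ∑ i, min (singVals B i) c := by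
  classical
  obtain ⟨Y, hY⟩ : ∃ Y, Y = A + B := ⟨_, rfl⟩
  obtain ⟨U, hU, hA⟩ := exists_transpose_mul_self_eq_diagIn A
  obtain ⟨W, hW, hB⟩ := exists_transpose_mul_self_eq_diagIn B
  obtain ⟨V, hV, hYV⟩ := exists_transpose_mul_self_eq_diagIn Y
  set fA : Fin N → ℝ := fun i => if singVals A i ≤ c then 1 else 0
  set gA : Fin N → ℝ := fun i => if singVals A i ≤ c then 0 else 1
  set fB : Fin N → ℝ := fun i => if singVals B i ≤ c then 1 else 0
  set gB : Fin N → ℝ := fun i => if singVals B i ≤ c then 0 else 1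
  have hAs : A = A * diagIn U fA + A * diagIn U gA := by
    rw [← Matrix.mul_add, diagIn_add]
    conv_lhs => rw [← Matrix.mul_one A, ← diagIn_one hU]
    congr 2
    ext i
    by_cases h : singVals A i ≤ c <;> simp [fA, gA, h]
  have hBs : B = B * diagIn W fB + B * diagIn W gB := by
    rw [← Matrix.mul_add, diagIn_add]
    conv_lhs => rw [← Matrix.mul_one B, ← diagIn_one hW]
    congr 2
    ext i
    by_cases h : singVals B i ≤ c <;> simp [fB, gB, h]
  set T := A * diagIn U gA + B * diagIn W gB with hT
  obtain ⟨Q, hQ, hTQ⟩ := exists_transpose_mul_self_eq_diagIn T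
  set P := diagIn Q (fun i => if singVals T i = 0 then 1 else 0) with hPdef
  set P' := diagIn Q (fun i => if singVals T i = 0 then 0 else 1) with hP'def
  have hPs : Pᵀ = P := diagIn_transpose _
  have hP's : P'ᵀ = P' := diagIn_transpose _
  have hPP : P * P = P := by
    rw [hPdef, diagIn_mul hQ]
    congr 1; ext i; split_ifs <;> simp
  have hPP' : P' * P' = P' := by
    rw [hP'def, diagIn_mul hQ]
    congr 1; ext i; split_ifs <;> simp
  have hsum : P + P' = 1 := by
    rw [hPdef, hP'def, diagIn_add, ← diagIn_one hQ]
    congr 1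
    ext i
    by_cases h : singVals T i = 0 <;> simp [h]
  have hTP : T * P = 0 := by
    refine mul_diagIn_eq_zero hQ hTQ fun i => ?_
    by_cases h : singVals T i = 0 <;> simp [h]
  have htr : P'.trace ≤ ∑ i, gA i + ∑ i, gB i := by
    have h1 : P'.trace = T.rank := by
      rw [hP'def, trace_diagIn hQ, ← card_singVals_ne_zero, Finset.card_filter, Nat.cast_sum]
      refine Finset.sum_congr rfl fun i _ => ?_
      by_cases h : singVals T i = 0 <;> simp [h]
    have h2 : T.rank ≤ (Finset.univ.filter fun i => gA i ≠ 0).card +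
        (Finset.univ.filter fun i => gB i ≠ 0).card :=
      (rank_add_le_rank_add_rank _ _).trans (add_le_add
        ((rank_mul_le_right _ _).trans (rank_diagIn_le _))
        ((rank_mul_le_right _ _).trans (rank_diagIn_le _)))
    have h3 : ∀ g : Fin N → ℝ, (∀ i, g i = 0 ∨ g i = 1) →
        ((Finset.univ.filter fun i => g i ≠ 0).card : ℝ) = ∑ i, g i := by
      intro g hg
      rw [Finset.card_filter, Nat.cast_sum]
      refine Finset.sum_congr rfl fun i _ => ?_
      rcases hg i with h | h <;> simp [h]
    rw [h1, ← h3 gA, ← h3 gB]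
    · exact_mod_cast h2
    · intro i; by_cases h : singVals B i ≤ c <;> simp [gB, h]
    · intro i; by_cases h : singVals A i ≤ c <;> simp [gA, h]
  set y := singVals Y with hy
  set S := diagIn V (fun i => (y i)⁻¹) * Yᵀ with hS
  have hSY : S * Y = diagIn V y := by
    rw [hS, Matrix.mul_assoc, hYV, diagIn_mul hV]
    congr 1
    ext i
    by_cases h : y i = 0
    · simp [h]
    · field_simp
  have hYt : Y * diagIn V (fun i => (y i)⁻¹ ^ 2) * Yᵀ * (Y * diagIn V (fun i => (y i)⁻¹ ^ 2) * Yᵀ) =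
      Y * diagIn V (fun i => (y i)⁻¹ ^ 2) * Yᵀ := by
    have : diagIn V (fun i => (y i)⁻¹ ^ 2) * (Yᵀ * Y) * diagIn V (fun i => (y i)⁻¹ ^ 2) =
        diagIn V (fun i => (y i)⁻¹ ^ 2) := by
      rw [hYV, diagIn_mul hV, diagIn_mul hV]
      congr 1
      ext i
      by_cases h : y i = 0
      · simp [h]
      · field_simp
    calc _ = Y * (diagIn V (fun i => (y i)⁻¹ ^ 2) * (Yᵀ * Y) *
            diagIn V (fun i => (y i)⁻¹ ^ 2)) * Yᵀ := by simp only [Matrix.mul_assoc]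
      _ = _ := by rw [this]
  have hScontr : ∀ x, (S *ᵥ x) ⬝ᵥ (S *ᵥ x) ≤ x ⬝ᵥ x := by
    intro x
    have h1 : Sᵀ * S = Y * diagIn V (fun i => (y i)⁻¹ ^ 2) * Yᵀ := by
      rw [hS, transpose_mul, transpose_transpose, diagIn_transpose, Matrix.mul_assoc,
        ← Matrix.mul_assoc (diagIn V _), diagIn_mul hV, ← Matrix.mul_assoc]
      simp only [pow_two]
    have h2 : (Y * diagIn V (fun i => (y i)⁻¹ ^ 2) * Yᵀ)ᵀ =
        Y * diagIn V (fun i => (y i)⁻¹ ^ 2) * Yᵀ := by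
      rw [transpose_mul, transpose_mul, transpose_transpose, diagIn_transpose, Matrix.mul_assoc]
    rw [mulVec_dotProduct_mulVec_self, h1, mulVec_dotProduct_of_projection h2 hYt]
    exact mulVec_dotProduct_self_le_of_projection h2 hYt x
  have hKcontr : ∀ x, ((P * S) *ᵥ x) ⬝ᵥ ((P * S) *ᵥ x) ≤ x ⬝ᵥ x := by
    intro x
    rw [← mulVec_mulVec]
    exact (mulVec_dotProduct_self_le_of_projection hPs hPP _).trans (hScontr x)
  have hYP : Y * P = (A * diagIn U fA + B * diagIn W fB) * P := by
    have : Y = A * diagIn U fA + B * diagIn W fB + T := by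
      rw [hY, hT]
      conv_lhs => rw [hAs, hBs]
      abel
    rw [this, Matrix.add_mul _ T, hTP, add_zero]
  have hmain : (P * diagIn V y).trace ≤ ∑ i, fA i * singVals A i + ∑ i, fB i * singVals B i := by
    have : (P * diagIn V y).trace =
        ((P * S) * (A * diagIn U fA)).trace + ((P * S) * (B * diagIn W fB)).trace := by
      have hcyc : ∀ R Z, (P * R * Z).trace = (P * R * (Z * P)).trace := by
        intro R Z
        rw [← Matrix.mul_assoc (P * R) Z P, Matrix.trace_mul_comm _ P, ← Matrix.mul_assoc,
          ← Matrix.mul_assoc, hPP]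
      rw [← hSY, ← Matrix.mul_assoc, hcyc, hYP, ← hcyc, Matrix.mul_add, trace_add]
    rw [this]
    refine add_le_add (trace_contraction_mul_le hU hA hKcontr fun i => ?_)
      (trace_contraction_mul_le hW hB hKcontr fun i => ?_)
    · by_cases h : singVals A i ≤ c <;> simp [fA, h]
    · by_cases h : singVals B i ≤ c <;> simp [fB, h]
  have hfinal : ∑ i, min (y i) c ≤ (P * diagIn V y).trace + c * P'.trace := by
    have h1 : ∑ i, min (y i) c = ((P + P') * diagIn V (fun i => min (y i) c)).trace := by
      rw [hsum, Matrix.one_mul, trace_diagIn hV]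
    have h2 : P'.trace = (P' * diagIn V (fun _ => 1)).trace := by
      rw [diagIn_one hV, Matrix.mul_one]
    rw [h1, Matrix.add_mul, trace_add, h2, trace_mul_diagIn, trace_mul_diagIn, trace_mul_diagIn,
      trace_mul_diagIn, Finset.mul_sum]
    refine add_le_add (Finset.sum_le_sum fun i _ => ?_) (Finset.sum_le_sum fun i _ => ?_)
    · rw [mulVec_dotProduct_of_projection hPs hPP]
      exact mul_le_mul_of_nonneg_right (min_le_left _ _) (zero_le_dotProduct_self _)
    · rw [mulVec_dotProduct_of_projection hP's hPP', one_mul]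
      exact mul_le_mul_of_nonneg_right (min_le_right _ _) (zero_le_dotProduct_self _)
  have hsplit : ∀ (Z : Matrix (Fin N) (Fin N) ℝ), ∑ i, min (singVals Z i) c =
      ∑ i, (if singVals Z i ≤ c then (1 : ℝ) else 0) * singVals Z i +
        c * ∑ i, (if singVals Z i ≤ c then (0 : ℝ) else 1) := by
    intro Z
    rw [Finset.mul_sum, ← Finset.sum_add_distrib]
    refine Finset.sum_congr rfl fun i _ => ?_
    by_cases h : singVals Z i ≤ c
    · simp [h]
    · simp [h, (not_le.mp h).le]
  rw [← hY, hsplit A, hsplit B]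
  have := mul_le_mul_of_nonneg_left htr hc
  linarith

end Triangle

section PowerSums

open Matrix MeasureTheory Set

theorem integral_min_mul_rpow {r : ℝ} (hr0 : 0 < r) (hr1 : r < 1) {t : ℝ} (ht : 0 ≤ t) :
    IntegrableOn (fun c : ℝ => min t c * c ^ (r - 2)) (Ioi 0) ∧
      ∫ c in Ioi (0 : ℝ), min t c * c ^ (r - 2) = t ^ r * (1 / r + 1 / (1 - r)) := by
  rcases ht.eq_or_lt with rfl | ht
  · have h : EqOn (fun c : ℝ => min 0 c * c ^ (r - 2)) (fun _ => 0) (Ioi 0) := by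
      intro c hc
      simp [min_eq_left (le_of_lt (mem_Ioi.mp hc))]
    refine ⟨integrableOn_zero.congr_fun h.symm measurableSet_Ioi, ?_⟩
    rw [setIntegral_congr_fun measurableSet_Ioi h]
    simp [Real.zero_rpow hr0.ne']
  · have h1 : EqOn (fun c : ℝ => c ^ (r - 1)) (fun c : ℝ => min t c * c ^ (r - 2)) (Ioc 0 t) := by
      intro c hc
      simp only
      rw [min_eq_right hc.2, mul_comm, ← Real.rpow_add_one hc.1.ne']
      congr 1
      ring
    have h2 : EqOn (fun c : ℝ => t * c ^ (r - 2)) (fun c : ℝ => min t c * c ^ (r - 2))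
        (Ioi t) := by
      intro c hc
      simp only
      rw [min_eq_left (le_of_lt hc)]
    have i1 : IntegrableOn (fun c : ℝ => min t c * c ^ (r - 2)) (Ioc 0 t) :=
      ((intervalIntegrable_iff_integrableOn_Ioc_of_le ht.le).mp
        (intervalIntegral.intervalIntegrable_rpow' (by linarith))).congr_fun h1 measurableSet_Ioc
    have i2 : IntegrableOn (fun c : ℝ => min t c * c ^ (r - 2)) (Ioi t) :=
      IntegrableOn.congr_fun
        ((integrableOn_Ioi_rpow_of_lt (a := r - 2) (by linarith) ht).const_mul t) h2
        measurableSet_Ioi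
    have hu : Ioc 0 t ∪ Ioi t = Ioi 0 := Ioc_union_Ioi_eq_Ioi ht.le
    refine ⟨hu ▸ i1.union i2, ?_⟩
    rw [← hu, setIntegral_union (Ioc_disjoint_Ioi le_rfl) measurableSet_Ioi i1 i2,
      ← setIntegral_congr_fun measurableSet_Ioc h1,
      ← setIntegral_congr_fun measurableSet_Ioi h2, ← intervalIntegral.integral_of_le ht.le,
      integral_rpow (Or.inl (by linarith)), integral_const_mul,
      integral_Ioi_rpow_of_lt (by linarith) ht]
    have h3 : t ^ (r - 2 + 1) = t ^ r / t := by
      rw [← Real.rpow_sub_one ht.ne']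
      congr 1
      ring
    have h4 : r - 1 ≠ 0 := by linarith
    have h5 : 1 - r ≠ 0 := by linarith
    have h6 : r - 2 + 1 = -(1 - r) := by ring
    rw [h3, h6, sub_add_cancel, Real.zero_rpow hr0.ne']
    field_simp
    ring

theorem sum_rpow_le_of_sum_min_le {ι κ : Type*} [Fintype ι] [Fintype κ] {y : ι → ℝ} {z : κ → ℝ}
    (hy : ∀ i, 0 ≤ y i) (hz : ∀ j, 0 ≤ z j)
    (h : ∀ c : ℝ, 0 ≤ c → ∑ i, min (y i) c ≤ ∑ j, min (z j) c) {r : ℝ} (hr0 : 0 < r)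
    (hr1 : r ≤ 1) : ∑ i, y i ^ r ≤ ∑ j, z j ^ r := by
  rcases hr1.eq_or_lt with rfl | hr1
  · have h1 := h (∑ i, y i) (Finset.sum_nonneg fun i _ => hy i)
    simp only [Real.rpow_one]
    refine le_trans (le_of_eq ?_) (h1.trans (Finset.sum_le_sum fun j _ => min_le_left _ _))
    refine Finset.sum_congr rfl fun i _ => (min_eq_left ?_).symm
    exact Finset.single_le_sum (fun i _ => hy i) (Finset.mem_univ i)
  · have hK : 0 < 1 / r + 1 / (1 - r) := by
      have : 0 < 1 - r := by linarith
      positivity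
    refine le_of_mul_le_mul_right ?_ hK
    rw [Finset.sum_mul, Finset.sum_mul]
    simp_rw [← fun i => (integral_min_mul_rpow hr0 hr1 (hy i)).2,
      ← fun i => (integral_min_mul_rpow hr0 hr1 (hz i)).2]
    rw [← integral_finsetSum _ fun i _ => (integral_min_mul_rpow hr0 hr1 (hy i)).1,
      ← integral_finsetSum _ fun i _ => (integral_min_mul_rpow hr0 hr1 (hz i)).1]
    refine setIntegral_mono_on
      (integrable_finsetSum _ fun i _ => (integral_min_mul_rpow hr0 hr1 (hy i)).1)
      (integrable_finsetSum _ fun i _ => (integral_min_mul_rpow hr0 hr1 (hz i)).1)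
      measurableSet_Ioi fun c hc => ?_
    rw [← Finset.sum_mul, ← Finset.sum_mul]
    exact mul_le_mul_of_nonneg_right (h c (le_of_lt hc)) (Real.rpow_nonneg (le_of_lt hc) _)

/-- The `r`-triangle inequality for Schatten quasi-norms with `r ≤ 1`. -/
theorem sum_rpow_singVals_add_le {N : ℕ} (A B : Matrix (Fin N) (Fin N) ℝ) {r : ℝ} (hr0 : 0 < r)
    (hr1 : r ≤ 1) :
    ∑ i, singVals (A + B) i ^ r ≤ ∑ i, singVals A i ^ r + ∑ i, singVals B i ^ r := by
  have := sum_rpow_le_of_sum_min_le (y := singVals (A + B))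
    (z := Sum.elim (singVals A) (singVals B)) (singVals_nonneg _)
    (by rintro (j | j) <;> exact singVals_nonneg _ _)
    (fun c hc => by simpa using sum_min_singVals_add_le A B hc) hr0 hr1
  simpa using this

/-- Hölder interpolation of power sums between the exponents `r` and `2`. -/
theorem sum_rpow_le_interpolation {ι : Type*} [Fintype ι] {s : ι → ℝ} (hs : ∀ i, 0 ≤ s i)
    {r q : ℝ} (hr : 0 < r) (hrq : r ≤ q) (hq : q ≤ 2) (hr2 : r < 2) :
    ∑ i, s i ^ q ≤
      (∑ i, s i ^ r) ^ ((2 - q) / (2 - r)) * (∑ i, s i ^ 2) ^ ((q - r) / (2 - r)) := by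
  have h2r : 0 < 2 - r := by linarith
  rcases hrq.eq_or_lt with rfl | hrq
  · simp [div_self h2r.ne']
  rcases hq.eq_or_lt with rfl | hq
  · simp [div_self h2r.ne']
  have hqr : 0 < q - r := by linarith
  have h2q : 0 < 2 - q := by linarith
  have key := Real.inner_le_Lp_mul_Lq_of_nonneg (s := Finset.univ)
    (f := fun i => s i ^ (r * ((2 - q) / (2 - r)))) (g := fun i => s i ^ (2 * ((q - r) / (2 - r))))
    (p := (2 - r) / (2 - q)) (q := (2 - r) / (q - r))
    ⟨by rw [inv_div, inv_div, inv_one]; field_simp; ring, by positivity, by positivity⟩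
    (fun i _ => Real.rpow_nonneg (hs i) _) (fun i _ => Real.rpow_nonneg (hs i) _)
  refine le_trans (le_of_eq ?_) (key.trans (le_of_eq ?_))
  · refine Finset.sum_congr rfl fun i _ => ?_
    rw [← Real.rpow_add' (hs i)]
    · congr 1
      field_simp
      ring
    · have : r * ((2 - q) / (2 - r)) + 2 * ((q - r) / (2 - r)) = q := by
        field_simp
        ring
      rw [this]
      linarith
  · rw [one_div_div, one_div_div]
    congr 3
    · ext i
      rw [← Real.rpow_mul (hs i)]
      congr 1
      field_simp
    · ext i
      rw [← Real.rpow_mul (hs i), ← Real.rpow_natCast]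
      congr 1
      push_cast
      field_simp

/-- Comparison of the Schatten `r`-quasi-norm and the Frobenius norm on matrices of small rank. -/
theorem sum_rpow_singVals_le_of_rank_le {N : ℕ} (B : Matrix (Fin N) (Fin N) ℝ) {κ r : ℝ}
    (hB : (B.rank : ℝ) ≤ κ) (hr0 : 0 < r) (hr1 : r ≤ 1) :
    ∑ i, singVals B i ^ r ≤ κ ^ (1 - r / 2) * (Bᵀ * B).trace ^ (r / 2) := by
  have hκ : 0 ≤ κ := (Nat.cast_nonneg _).trans hB
  have key := Real.inner_le_Lp_mul_Lq_of_nonneg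
    (s := Finset.univ.filter fun i => singVals B i ≠ 0)
    (f := fun i => 1) (g := fun i => singVals B i ^ r)
    (p := 1 / (1 - r / 2)) (q := 2 / r)
    ⟨by rw [inv_div, inv_div]; ring, one_div_pos.mpr (by linarith), by positivity⟩
    (fun i _ => zero_le_one) (fun i _ => Real.rpow_nonneg (singVals_nonneg _ _) _)
  simp only [one_mul, Real.one_rpow, Finset.sum_const, nsmul_eq_mul, mul_one, one_div_div,
    div_one, card_singVals_ne_zero] at key
  have h1 : ∀ i, (singVals B i ^ r) ^ (2 / r) = singVals B i ^ 2 := by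
    intro i
    rw [← Real.rpow_mul (singVals_nonneg _ _), mul_div_cancel₀ _ hr0.ne']
    norm_num
  simp only [h1] at key
  rw [Finset.sum_filter_of_ne, Finset.sum_filter_of_ne, sum_sq_singVals] at key
  · refine key.trans (mul_le_mul_of_nonneg_right ?_ (Real.rpow_nonneg ?_ _))
    · exact Real.rpow_le_rpow (Nat.cast_nonneg _) hB (by linarith)
    · rw [← sum_sq_singVals]
      exact Finset.sum_nonneg fun i _ => sq_nonneg _
  · intro i _ h h0
    simp [h0] at h
  · intro i _ h h0
    simp [h0, Real.zero_rpow hr0.ne'] at h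

end PowerSums

section Rademacher

open Finset

/-- The sign `±1` attached to a Boolean. -/
def boolSign (b : Bool) : ℝ := if b then 1 else -1

theorem boolSign_not (b : Bool) : boolSign (!b) = -boolSign b := by
  cases b <;> simp [boolSign]

variable {ι : Type*} [Fintype ι] [DecidableEq ι]

/-- The partial Rademacher sum `∑_{j ∈ s} ε_j z_j`. -/
def signSum (z : ι → ℝ) (s : Finset ι) (ε : ι → Bool) : ℝ := ∑ j ∈ s, boolSign (ε j) * z j

theorem sum_signSum_insert (z : ι → ℝ) {s : Finset ι} {a : ι} (ha : a ∉ s) (F : ℝ → ℝ) :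
    ∑ ε, F (signSum z (insert a s) ε) =
      ∑ ε, (F (signSum z s ε + z a) + F (signSum z s ε - z a)) / 2 := by
  let flip : (ι → Bool) ≃ (ι → Bool) :=
    { toFun := fun ε => Function.update ε a (!ε a)
      invFun := fun ε => Function.update ε a (!ε a)
      left_inv := fun ε => by simp
      right_inv := fun ε => by simp }
  have hins : ∀ ε, signSum z (insert a s) ε = boolSign (ε a) * z a + signSum z s ε := fun ε =>
    sum_insert ha
  have hflip : ∀ ε, signSum z (insert a s) (flip ε) = -(boolSign (ε a) * z a) + signSum z s ε := by
    intro ε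
    rw [hins]
    congr 1
    · simp [flip, boolSign_not]
    · refine sum_congr rfl fun j hj => ?_
      have : j ≠ a := fun h => ha (h ▸ hj)
      simp [flip, this]
  have h1 : ∑ ε, F (signSum z (insert a s) (flip ε)) = ∑ ε, F (signSum z (insert a s) ε) :=
    Equiv.sum_comp flip fun ε => F (signSum z (insert a s) ε)
  have h2 : ∑ ε, F (signSum z (insert a s) ε) =
      ∑ ε, (F (signSum z (insert a s) ε) + F (signSum z (insert a s) (flip ε))) / 2 := by
    rw [← sum_div, sum_add_distrib, h1]
    ring
  rw [h2]
  refine sum_congr rfl fun ε _ => ?_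
  rw [hins, hflip]
  cases h : ε a
  · simp only [boolSign, Bool.false_eq_true, if_false]
    ring_nf
  · simp only [boolSign, if_true]
    ring_nf

theorem sum_sq_signSum (z : ι → ℝ) (s : Finset ι) :
    ∑ ε, signSum z s ε ^ 2 = Fintype.card (ι → Bool) * ∑ j ∈ s, z j ^ 2 := by
  induction s using Finset.induction_on with
  | empty => simp [signSum]
  | insert a s ha ih =>
    rw [sum_signSum_insert z ha (· ^ 2), sum_insert ha, mul_add, ← ih]
    have : ∀ ε, ((signSum z s ε + z a) ^ 2 + (signSum z s ε - z a) ^ 2) / 2 =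
        z a ^ 2 + signSum z s ε ^ 2 := fun ε => by ring
    simp_rw [this, sum_add_distrib]
    simp

theorem sum_pow_four_signSum_le (z : ι → ℝ) (s : Finset ι) :
    ∑ ε, signSum z s ε ^ 4 ≤ Fintype.card (ι → Bool) * (3 * (∑ j ∈ s, z j ^ 2) ^ 2) := by
  induction s using Finset.induction_on with
  | empty => simp [signSum]
  | insert a s ha ih =>
    rw [sum_signSum_insert z ha (· ^ 4), sum_insert ha]
    have : ∀ ε, ((signSum z s ε + z a) ^ 4 + (signSum z s ε - z a) ^ 4) / 2 =
        signSum z s ε ^ 4 + 6 * z a ^ 2 * signSum z s ε ^ 2 + z a ^ 4 := fun ε => by ring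
    simp_rw [this, sum_add_distrib, ← mul_sum, sum_sq_signSum]
    rw [sum_const, card_univ, nsmul_eq_mul]
    nlinarith [mul_nonneg (Nat.cast_nonneg (α := ℝ) (Fintype.card (ι → Bool)))
      (sq_nonneg (z a ^ 2))]

theorem exp_sq_add_exp_sq_le (l x a : ℝ) :
    (Real.exp (l * (x + a) ^ 2) + Real.exp (l * (x - a) ^ 2)) / 2 ≤
      Real.exp (l * a ^ 2) * Real.exp (l * (1 + 2 * l * a ^ 2) * x ^ 2) := by
  have h := Real.cosh_le_exp_half_sq (2 * l * x * a)
  have h1 : (Real.exp (l * (x + a) ^ 2) + Real.exp (l * (x - a) ^ 2)) / 2 =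
      Real.exp (l * x ^ 2 + l * a ^ 2) * Real.cosh (2 * l * x * a) := by
    rw [Real.cosh_eq, mul_div_assoc', mul_add, ← Real.exp_add, ← Real.exp_add]
    ring_nf
  rw [h1, ← Real.exp_add]
  refine (mul_le_mul_of_nonneg_left h (Real.exp_pos _).le).trans ?_
  rw [← Real.exp_add]
  exact le_of_eq (by ring_nf)

theorem sum_exp_sq_signSum_le (z : ι → ℝ) (s : Finset ι) (l : ℝ) (hl : 0 ≤ l)
    (h : 2 * l * ∑ j ∈ s, z j ^ 2 < 1) :
    ∑ ε, Real.exp (l * signSum z s ε ^ 2) ≤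
      Fintype.card (ι → Bool) / (1 - 2 * l * ∑ j ∈ s, z j ^ 2) := by
  induction s using Finset.induction_on generalizing l with
  | empty => simp [signSum]
  | insert a s ha ih =>
    rw [sum_signSum_insert z ha fun x => Real.exp (l * x ^ 2)]
    rw [sum_insert ha] at h ⊢
    have hS : 0 ≤ ∑ j ∈ s, z j ^ 2 := sum_nonneg fun j _ => sq_nonneg _
    obtain ⟨S, hSd⟩ : ∃ S, S = ∑ j ∈ s, z j ^ 2 := ⟨_, rfl⟩
    rw [← hSd] at h hS ih ⊢
    obtain ⟨x, hx⟩ : ∃ x, x = 2 * l * S := ⟨_, rfl⟩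
    obtain ⟨y, hy⟩ : ∃ y, y = 2 * l * z a ^ 2 := ⟨_, rfl⟩
    have hx0 : 0 ≤ x := hx ▸ by positivity
    have hy0 : 0 ≤ y := hy ▸ by positivity
    have hxy : x + y < 1 := by rw [hx, hy]; linarith
    have h1 : 2 * (l * (1 + 2 * l * z a ^ 2)) * S = x + x * y := by rw [hx, hy]; ring
    have hpos : 0 < 1 - (x + x * y) := by nlinarith
    have hI := ih (l * (1 + 2 * l * z a ^ 2)) (by positivity) (by rw [h1]; linarith)
    rw [h1] at hI
    have h2 : 1 - 2 * l * (z a ^ 2 + S) = 1 - x - y := by rw [hx, hy]; ring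
    rw [h2]
    refine (sum_le_sum fun ε _ => exp_sq_add_exp_sq_le l _ (z a)).trans ?_
    rw [← mul_sum]
    refine (mul_le_mul_of_nonneg_left hI (Real.exp_pos _).le).trans ?_
    have h3 : l * z a ^ 2 = y / 2 := by rw [hy]; ring
    have h4 : Real.exp (y / 2) ≤ 1 / (1 - y / 2) := Real.exp_bound_div_one_sub_of_interval
      (by linarith) (by linarith)
    rw [h3, mul_div_assoc', div_le_div_iff₀ hpos (by linarith)]
    have h5 : Real.exp (y / 2) * (1 - x - y) ≤ 1 - (x + x * y) := by
      refine (mul_le_mul_of_nonneg_right h4 (by linarith)).trans ?_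
      rw [one_div_mul_eq_div, div_le_iff₀ (by linarith)]
      nlinarith [mul_nonneg hx0 hy0, mul_nonneg (mul_nonneg hx0 hy0) hy0,
        mul_nonneg hy0 (by linarith : 0 ≤ 1 - x)]
    nlinarith [mul_le_mul_of_nonneg_left h5 (Nat.cast_nonneg (α := ℝ) (Fintype.card (ι → Bool)))]

theorem sum_exp_quarter_sq_signSum_le {z : ι → ℝ} (hz : ∑ j, z j ^ 2 = 1) :
    ∑ ε, Real.exp (signSum z univ ε ^ 2 / 4) ≤ 2 * Fintype.card (ι → Bool) := by
  have h := sum_exp_sq_signSum_le z univ (1 / 4) (by norm_num) (by rw [hz]; norm_num)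
  rw [hz] at h
  simp_rw [one_div_mul_eq_div] at h
  exact h.trans (le_of_eq (by ring))

theorem exp_neg_le_quadratic {t : ℝ} (ht : 0 ≤ t) : Real.exp (-t) ≤ 1 - t + t ^ 2 / 2 := by
  have h := Real.quadratic_le_exp_of_nonneg ht
  rw [Real.exp_neg, inv_le_comm₀ (Real.exp_pos _) (by nlinarith [sq_nonneg (t - 1)])]
  refine le_trans ?_ h
  rw [inv_le_iff_one_le_mul₀ (by nlinarith [sq_nonneg (t - 1)])]
  nlinarith [sq_nonneg (t ^ 2)]

theorem sum_exp_neg_third_sq_signSum_le {z : ι → ℝ} (hz : ∑ j, z j ^ 2 = 1) :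
    ∑ ε, Real.exp (-(signSum z univ ε ^ 2 / 3)) ≤ 5 / 6 * Fintype.card (ι → Bool) := by
  have h4 := sum_pow_four_signSum_le z univ
  have h2 := sum_sq_signSum z univ
  rw [hz] at h4 h2
  have h : ∀ ε, Real.exp (-(signSum z univ ε ^ 2 / 3)) ≤
      1 - signSum z univ ε ^ 2 / 3 + signSum z univ ε ^ 4 / 18 := fun ε =>
    (exp_neg_le_quadratic (by positivity)).trans (le_of_eq (by ring))
  refine (sum_le_sum fun ε _ => h ε).trans ?_
  rw [sum_add_distrib, sum_sub_distrib, ← sum_div, ← sum_div, h2, sum_const, card_univ,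
    nsmul_eq_mul]
  linarith

/-- Chernoff bounds: for a unit vector, few sign matrices distort the norm by more than `2`. -/
theorem card_bad_sign_matrices_le (m : ℕ) {z : ι → ℝ} (hz : ∑ j, z j ^ 2 = 1) :
    (#{ε : Fin m → ι → Bool | ¬((m : ℝ) / 4 ≤ ∑ i, signSum z univ (ε i) ^ 2 ∧
      ∑ i, signSum z univ (ε i) ^ 2 ≤ 4 * m)} : ℝ) ≤
      2 * (10 / 11) ^ m * Fintype.card (Fin m → ι → Bool) := by
  have hcard : (Fintype.card (Fin m → ι → Bool) : ℝ) = (Fintype.card (ι → Bool) : ℝ) ^ m := by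
    simp
  have hprod : ∀ (G : ℝ → ℝ) (ε : Fin m → ι → Bool),
      ∏ i, Real.exp (G (signSum z univ (ε i))) = Real.exp (∑ i, G (signSum z univ (ε i))) :=
    fun G ε => (Real.exp_sum _ _).symm
  have hfub : ∀ G : ℝ → ℝ, ∑ ε : Fin m → ι → Bool, Real.exp (∑ i, G (signSum z univ (ε i))) =
      (∑ ε, Real.exp (G (signSum z univ ε))) ^ m := by
    intro G
    simp_rw [← hprod]
    exact (Fintype.sum_pow (fun ε => Real.exp (G (signSum z univ ε))) m).symm
  have hup : ∑ ε : Fin m → ι → Bool, Real.exp (∑ i, (signSum z univ (ε i) ^ 2 / 4 - 1)) ≤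
      (10 / 11) ^ m * Fintype.card (Fin m → ι → Bool) := by
    rw [hfub fun x => x ^ 2 / 4 - 1, hcard, ← mul_pow]
    refine pow_le_pow_left₀ (sum_nonneg fun _ _ => (Real.exp_pos _).le) ?_ m
    simp_rw [Real.exp_sub, ← sum_div]
    rw [div_le_iff₀ (Real.exp_pos _)]
    have he : (11 : ℝ) / 5 ≤ Real.exp 1 := by linarith [Real.exp_one_gt_d9]
    refine (sum_exp_quarter_sq_signSum_le hz).trans ?_
    have hM : (0 : ℝ) ≤ Fintype.card (ι → Bool) := Nat.cast_nonneg _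
    nlinarith [mul_le_mul_of_nonneg_left he hM]
  have hlow : ∑ ε : Fin m → ι → Bool,
      Real.exp (∑ i, (1 / 12 + -(signSum z univ (ε i) ^ 2 / 3))) ≤
      (10 / 11) ^ m * Fintype.card (Fin m → ι → Bool) := by
    rw [hfub fun x => 1 / 12 + -(x ^ 2 / 3), hcard, ← mul_pow]
    refine pow_le_pow_left₀ (sum_nonneg fun _ _ => (Real.exp_pos _).le) ?_ m
    simp_rw [Real.exp_add, ← mul_sum]
    have he : Real.exp (1 / 12) ≤ 12 / 11 :=
      (Real.exp_bound_div_one_sub_of_interval (by norm_num) (by norm_num)).trans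
        (by norm_num)
    refine (mul_le_mul he (sum_exp_neg_third_sq_signSum_le hz)
      (sum_nonneg fun _ _ => (Real.exp_pos _).le) (by norm_num)).trans (le_of_eq (by ring))
  rw [card_filter, Nat.cast_sum]
  refine le_trans (sum_le_sum (g := fun ε : Fin m → ι → Bool =>
    Real.exp (∑ i, (signSum z univ (ε i) ^ 2 / 4 - 1)) +
    Real.exp (∑ i, (1 / 12 + -(signSum z univ (ε i) ^ 2 / 3)))) fun ε _ => ?_) ?_
  · have e1 : ∑ i, (signSum z univ (ε i) ^ 2 / 4 - 1) =
        (∑ i, signSum z univ (ε i) ^ 2) / 4 - m := by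
      rw [sum_sub_distrib, ← sum_div]
      simp
    have e2 : ∑ i, (1 / 12 + -(signSum z univ (ε i) ^ 2 / 3)) =
        m / 12 - (∑ i, signSum z univ (ε i) ^ 2) / 3 := by
      rw [sum_add_distrib, sum_neg_distrib, ← sum_div (f := fun i => signSum z univ (ε i) ^ 2)]
      simp
      ring
    rw [e1, e2]
    have p1 := Real.exp_pos ((∑ i, signSum z univ (ε i) ^ 2) / 4 - m)
    have p2 := Real.exp_pos ((m : ℝ) / 12 - (∑ i, signSum z univ (ε i) ^ 2) / 3)
    by_cases hε : ¬((m : ℝ) / 4 ≤ ∑ i, signSum z univ (ε i) ^ 2 ∧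
      ∑ i, signSum z univ (ε i) ^ 2 ≤ 4 * m)
    · rw [if_pos hε, Nat.cast_one]
      rcases not_and_or.mp hε with h | h
      · have := Real.one_le_exp
          (x := (m : ℝ) / 12 - (∑ i, signSum z univ (ε i) ^ 2) / 3) (by linarith)
        linarith
      · have := Real.one_le_exp (x := (∑ i, signSum z univ (ε i) ^ 2) / 4 - m) (by linarith)
        linarith
    · rw [if_neg hε, Nat.cast_zero]
      linarith
  · rw [sum_add_distrib]
    linarith

/-- A random sign matrix almost preserves the norms of finitely many vectors. -/
theorem exists_linearMap_norm_bounds (m : ℕ) (T : Finset (ι → ℝ))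
    (hT : (#T : ℝ) * (2 * (10 / 11) ^ m) < 1) :
    ∃ A : (ι → ℝ) →ₗ[ℝ] EuclideanSpace ℝ (Fin m), ∀ z ∈ T,
      (m : ℝ) / 4 * ∑ j, z j ^ 2 ≤ ‖A z‖ ^ 2 ∧ ‖A z‖ ^ 2 ≤ 4 * m * ∑ j, z j ^ 2 := by
  classical
  let bad : (ι → ℝ) → Finset (Fin m → ι → Bool) := fun z =>
    {ε | ¬((m : ℝ) / 4 * ∑ j, z j ^ 2 ≤ ∑ i, signSum z univ (ε i) ^ 2 ∧
      ∑ i, signSum z univ (ε i) ^ 2 ≤ 4 * m * ∑ j, z j ^ 2)}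
  have hbad : ∀ z, (#(bad z) : ℝ) ≤ 2 * (10 / 11) ^ m * Fintype.card (Fin m → ι → Bool) := by
    intro z
    have hS : 0 ≤ ∑ j, z j ^ 2 := sum_nonneg fun j _ => sq_nonneg _
    rcases hS.eq_or_lt with h0 | hS
    · have hz : ∀ j, z j = 0 := fun j => by
        have := (sum_eq_zero_iff_of_nonneg fun j _ => sq_nonneg (z j)).mp h0.symm j (mem_univ j)
        exact pow_eq_zero_iff two_ne_zero |>.mp this
      have : bad z = ∅ := by
        simp [bad, signSum, hz]
      rw [this, card_empty, Nat.cast_zero]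
      positivity
    · obtain ⟨c, hc⟩ : ∃ c, c = √(∑ j, z j ^ 2) := ⟨_, rfl⟩
      have hc0 : 0 < c := hc ▸ Real.sqrt_pos.mpr hS
      have hcc : c ^ 2 = ∑ j, z j ^ 2 := hc ▸ Real.sq_sqrt hS.le
      have hw : ∑ j, (z j / c) ^ 2 = 1 := by
        simp_rw [div_pow, ← sum_div]
        rw [← hcc, div_self (by positivity)]
      refine le_trans (le_of_eq ?_) (card_bad_sign_matrices_le m hw)
      congr 2
      ext ε
      have : ∀ η, signSum (fun j => z j / c) univ η = signSum z univ η / c := fun η => by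
        simp_rw [signSum, sum_div, mul_div_assoc]
      simp only [bad, mem_filter, mem_univ, true_and, this, div_pow, ← sum_div, ← hcc]
      rw [le_div_iff₀ (by positivity), div_le_iff₀ (by positivity)]
  have hun : (#(T.biUnion bad) : ℝ) < Fintype.card (Fin m → ι → Bool) := by
    calc (#(T.biUnion bad) : ℝ) ≤ ∑ z ∈ T, (#(bad z) : ℝ) := by exact_mod_cast card_biUnion_le
      _ ≤ ∑ z ∈ T, 2 * (10 / 11) ^ m * (Fintype.card (Fin m → ι → Bool) : ℝ) :=
        sum_le_sum fun z _ => hbad z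
      _ = #T * (2 * (10 / 11) ^ m) * Fintype.card (Fin m → ι → Bool) := by
        rw [sum_const, nsmul_eq_mul]
        ring
      _ < Fintype.card (Fin m → ι → Bool) := by
        have : (0 : ℝ) < Fintype.card (Fin m → ι → Bool) := by exact_mod_cast Fintype.card_pos
        nlinarith
  obtain ⟨ε, hε⟩ : ∃ ε, ε ∉ T.biUnion bad := by
    by_contra! h
    rw [eq_univ_of_forall h, card_univ] at hun
    exact lt_irrefl _ hun
  refine ⟨(WithLp.linearEquiv 2 ℝ (Fin m → ℝ)).symm.toLinearMap ∘ₗ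
    (Matrix.of fun i j => boolSign (ε i j)).mulVecLin, fun z hz => ?_⟩
  have h1 : ε ∉ bad z := fun h => hε (mem_biUnion.mpr ⟨z, hz, h⟩)
  simp only [bad, mem_filter, mem_univ, true_and, not_not] at h1
  have h2 : ‖((WithLp.linearEquiv 2 ℝ (Fin m → ℝ)).symm.toLinearMap ∘ₗ
    (Matrix.of fun i j => boolSign (ε i j)).mulVecLin) z‖ ^ 2 =
      ∑ i, signSum z univ (ε i) ^ 2 := by
    rw [EuclideanSpace.norm_sq_eq]
    simp [signSum, Matrix.mulVec, dotProduct]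
  rw [h2]
  exact h1

end Rademacher

section Nets

open Module Metric MeasureTheory

variable {E : Type*} [NormedAddCommGroup E] [NormedSpace ℝ E] [FiniteDimensional ℝ E]

/-- A `1 / 128`-separated subset of the unit ball has at most `257 ^ dim` elements. -/
theorem card_le_of_separated_unit_ball (s : Finset E) (hs : ∀ c ∈ s, ‖c‖ ≤ 1)
    (h : ∀ c ∈ s, ∀ d ∈ s, c ≠ d → 1 / 128 ≤ ‖c - d‖) : s.card ≤ 257 ^ finrank ℝ E := by
  borelize E
  let μ : Measure E := Measure.addHaar
  have D : Set.Pairwise (s : Set E)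
      (Function.onFun Disjoint fun c => ball (c : E) (1 / 256)) := by
    rintro c hc d hd hcd
    refine ball_disjoint_ball ?_
    rw [dist_eq_norm]
    exact le_trans (by norm_num) (h c hc d hd hcd)
  have hsub : (⋃ c ∈ s, ball (c : E) (1 / 256)) ⊆ ball (0 : E) (257 / 256) := by
    refine Set.iUnion₂_subset fun x hx => ball_subset_ball' ?_
    rw [dist_zero_right]
    linarith [hs x hx]
  have hvol : (s.card : ENNReal) * ENNReal.ofReal ((1 / 256) ^ finrank ℝ E) * μ (ball 0 1) ≤
      ENNReal.ofReal ((257 / 256) ^ finrank ℝ E) * μ (ball 0 1) := by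
    rw [← μ.addHaar_ball_of_pos 0 (by norm_num : (0 : ℝ) < 257 / 256)]
    refine le_trans (le_of_eq ?_) (measure_mono hsub)
    rw [measure_biUnion_finset D fun c _ => measurableSet_ball]
    simp only [μ.addHaar_ball_of_pos _ (by norm_num : (0 : ℝ) < 1 / 256), Finset.sum_const,
      nsmul_eq_mul, mul_assoc]
  have hle : (s.card : ENNReal) * ENNReal.ofReal ((1 / 256) ^ finrank ℝ E) ≤
      ENNReal.ofReal ((257 / 256) ^ finrank ℝ E) :=
    (ENNReal.mul_le_mul_iff_left (measure_ball_pos _ _ zero_lt_one).ne' measure_ball_lt_top.ne).1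
      hvol
  have hreal : (s.card : ℝ) ≤ (257 : ℝ) ^ finrank ℝ E := by
    have := ENNReal.toReal_le_of_le_ofReal (by positivity) hle
    simpa [div_eq_mul_inv, mul_pow] using this
  exact mod_cast hreal

/-- Every vector is approximated up to relative error `1 / 128` by a multiple of an element of
a suitable set with at most `257 ^ dim` elements. -/
theorem exists_relative_net : ∃ s : Finset E, s.card ≤ 257 ^ finrank ℝ E ∧
    ∀ x : E, ∃ y ∈ s, ‖x - ‖x‖ • y‖ ≤ 1 / 128 * ‖x‖ := by
  classical
  have hmax : ∃ s : Finset E, (∀ c ∈ s, ‖c‖ ≤ 1) ∧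
      (∀ c ∈ s, ∀ d ∈ s, c ≠ d → 1 / 128 ≤ ‖c - d‖) ∧
      ∀ x : E, ‖x‖ ≤ 1 → ∃ y ∈ s, ‖x - y‖ ≤ 1 / 128 := by
    by_contra! hcon
    have hgrow : ∀ n : ℕ, ∃ s : Finset E, s.card = n ∧ (∀ c ∈ s, ‖c‖ ≤ 1) ∧
        ∀ c ∈ s, ∀ d ∈ s, c ≠ d → 1 / 128 ≤ ‖c - d‖ := by
      intro n
      induction n with
      | zero => exact ⟨∅, by simp⟩
      | succ n ih =>
        obtain ⟨s, hn, h1, h2⟩ := ih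
        obtain ⟨x, hx1, hx⟩ := hcon s h1 h2
        have hxs : x ∉ s := fun hmem => by
          have := hx x hmem
          norm_num at this
        refine ⟨insert x s, by rw [Finset.card_insert_of_notMem hxs, hn], ?_, ?_⟩
        · simp only [Finset.mem_insert, forall_eq_or_imp]
          exact ⟨hx1, h1⟩
        · intro c hc d hd hcd
          rcases Finset.mem_insert.mp hc with rfl | hc
          · rcases Finset.mem_insert.mp hd with rfl | hd
            · exact absurd rfl hcd
            · exact (hx d hd).le
          · rcases Finset.mem_insert.mp hd with rfl | hd
            · rw [norm_sub_rev]
              exact (hx c ‹_›).le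
            · exact h2 c ‹_› d hd hcd
    obtain ⟨s, hn, h1, h2⟩ := hgrow (257 ^ finrank ℝ E + 1)
    have := card_le_of_separated_unit_ball s h1 h2
    omega
  obtain ⟨s, h1, h2, h3⟩ := hmax
  refine ⟨s, card_le_of_separated_unit_ball s h1 h2, fun x => ?_⟩
  rcases eq_or_ne x 0 with rfl | hx
  · obtain ⟨y, hy, -⟩ := h3 0 (by simp)
    exact ⟨y, hy, by simp⟩
  · have hx0 : 0 < ‖x‖ := norm_pos_iff.mpr hx
    obtain ⟨y, hy, hxy⟩ := h3 (‖x‖⁻¹ • x) (by rw [norm_smul]; simp [hx0.ne'])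
    refine ⟨y, hy, ?_⟩
    have : x - ‖x‖ • y = ‖x‖ • (‖x‖⁻¹ • x - y) := by
      rw [smul_sub, smul_smul, mul_inv_cancel₀ hx0.ne', one_smul]
    rw [this, norm_smul, norm_norm, mul_comm]
    exact mul_le_mul_of_nonneg_right hxy hx0.le

/-- Two-sided norm bounds of a linear map on a set of good points extend to every set whose
elements are successively approximated by good points. -/
theorem norm_bounds_of_approximation {F : Type*} [NormedAddCommGroup F] [NormedSpace ℝ F]
    (A : E →ₗ[ℝ] F) {K G : Set E} {a b ε : ℝ} (hab : a ≤ b) (hε0 : 0 ≤ ε) (hb : 0 < b)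
    (hε : 8 * (b * ε) ≤ a)
    (hG : ∀ y ∈ G, a * ‖y‖ ≤ ‖A y‖ ∧ ‖A y‖ ≤ b * ‖y‖)
    (hK : ∀ z ∈ K, ∃ y ∈ G, z - y ∈ K ∧ ‖z - y‖ ≤ ε * ‖z‖) {z : E} (hz : z ∈ K) :
    a / 2 * ‖z‖ ≤ ‖A z‖ ∧ ‖A z‖ ≤ 2 * b * ‖z‖ := by
  have hε8 : ε ≤ 1 / 8 := by
    by_contra! h
    nlinarith
  have ha : 0 ≤ a := by nlinarith [mul_nonneg hb.le hε0]
  let C := ‖LinearMap.toContinuousLinearMap A‖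
  have hC : ∀ z, ‖A z‖ ≤ C * ‖z‖ := fun z => (LinearMap.toContinuousLinearMap A).le_opNorm z
  have hC0 : 0 ≤ C := norm_nonneg _
  have hiter : ∀ n : ℕ, ∀ z ∈ K, ‖A z‖ ≤ (2 * b + C * ε ^ n) * ‖z‖ := by
    intro n
    induction n with
    | zero =>
      intro z _
      refine (hC z).trans (mul_le_mul_of_nonneg_right ?_ (norm_nonneg z))
      simp [hb.le]
    | succ n ih =>
      intro z hz
      obtain ⟨y, hy, hzy, hn⟩ := hK z hz
      have h1 : ‖A z‖ ≤ ‖A y‖ + ‖A (z - y)‖ := by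
        rw [← add_sub_cancel y z, map_add]
        simpa using norm_add_le (A y) (A (z - y))
      have h2 : ‖y‖ ≤ (1 + ε) * ‖z‖ := by
        have := norm_sub_le z (z - y)
        rw [sub_sub_cancel] at this
        linarith
      have h3 := ih _ hzy
      have h4 : 0 ≤ 2 * b + C * ε ^ n := by positivity
      have h5 : (2 * b + C * ε ^ n) * ‖z - y‖ ≤ (2 * b + C * ε ^ n) * (ε * ‖z‖) :=
        mul_le_mul_of_nonneg_left hn h4
      have h6 : b * ‖y‖ ≤ b * ((1 + ε) * ‖z‖) := mul_le_mul_of_nonneg_left h2 hb.le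
      have h7 : b * ε * ‖z‖ ≤ b * (1 / 8) * ‖z‖ := by gcongr
      rw [pow_succ]
      nlinarith [(hG y hy).2, mul_nonneg hb.le (norm_nonneg z)]
  have hup : ∀ z ∈ K, ‖A z‖ ≤ 2 * b * ‖z‖ := by
    intro z hz
    have hlim : Filter.Tendsto (fun n : ℕ => (2 * b + C * ε ^ n) * ‖z‖) Filter.atTop
        (nhds ((2 * b + C * 0) * ‖z‖)) :=
      (((tendsto_pow_atTop_nhds_zero_of_lt_one hε0 (by linarith)).const_mul C).const_add
        (2 * b)).mul_const ‖z‖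
    rw [mul_zero, add_zero] at hlim
    exact ge_of_tendsto' hlim fun n => hiter n z hz
  refine ⟨?_, hup z hz⟩
  obtain ⟨y, hy, hzy, hn⟩ := hK z hz
  have h1 : ‖A y‖ ≤ ‖A z‖ + ‖A (z - y)‖ := by
    have := norm_sub_le (A z) (A (z - y))
    rwa [← map_sub, sub_sub_cancel] at this
  have h2 : (1 - ε) * ‖z‖ ≤ ‖y‖ := by
    have := norm_add_le (z - y) y
    rw [sub_add_cancel] at this
    linarith
  have h3 := hup _ hzy
  have h4 : 2 * b * ‖z - y‖ ≤ 2 * b * (ε * ‖z‖) := mul_le_mul_of_nonneg_left hn (by linarith)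
  have h5 : a * ((1 - ε) * ‖z‖) ≤ a * ‖y‖ := mul_le_mul_of_nonneg_left h2 ha
  have h6 : 8 * (b * ε) * ‖z‖ ≤ a * ‖z‖ := mul_le_mul_of_nonneg_right hε (norm_nonneg z)
  have h7 : a * ε * ‖z‖ ≤ a * (1 / 8) * ‖z‖ := by gcongr
  nlinarith [(hG y hy).1, mul_nonneg ha (norm_nonneg z)]

end Nets

section LowRank

open Matrix Module

attribute [local instance] Matrix.frobeniusNormedAddCommGroup Matrix.frobeniusNormedSpace

theorem frobenius_norm_sq {m n : Type*} [Fintype m] [Fintype n] (Z : Matrix m n ℝ) :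
    ‖Z‖ ^ 2 = ∑ i, ∑ j, Z i j ^ 2 := by
  have h : 0 ≤ ∑ i, ∑ j, Z i j ^ 2 := by positivity
  rw [frobenius_norm_def, ← Real.sqrt_eq_rpow]
  simp only [Real.norm_eq_abs, Real.rpow_two, sq_abs]
  exact Real.sq_sqrt h

theorem frobenius_norm_sq_eq_trace {m n : Type*} [Fintype m] [Fintype n] (Z : Matrix m n ℝ) :
    ‖Z‖ ^ 2 = (Z * Zᵀ).trace := by
  rw [frobenius_norm_sq]
  simp [trace, mul_apply, pow_two]

theorem frobenius_norm_sq_eq_sum_columns {m n : Type*} [Fintype m] [Fintype n]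
    (Z : Matrix m n ℝ) : ‖Z‖ ^ 2 = ∑ j, ‖WithLp.toLp 2 (Zᵀ j)‖ ^ 2 := by
  rw [frobenius_norm_sq, Finset.sum_comm]
  simp [EuclideanSpace.norm_sq_eq]

theorem frobenius_norm_mul_of_mul_transpose_eq_one {m n κ : Type*} [Fintype m] [Fintype n]
    [Fintype κ] [DecidableEq κ] (B : Matrix m κ ℝ) {W : Matrix κ n ℝ} (hW : W * Wᵀ = 1) :
    ‖B * W‖ = ‖B‖ := by
  rw [← sq_eq_sq₀ (norm_nonneg _) (norm_nonneg _), frobenius_norm_sq_eq_trace,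
    frobenius_norm_sq_eq_trace, transpose_mul, Matrix.mul_assoc, ← Matrix.mul_assoc W, hW,
    Matrix.one_mul]

/-- Left multiplication by a fixed matrix as a linear map. -/
def mulLeftLin {N k : ℕ} (U : Matrix (Fin N) (Fin k) ℝ) :
    Matrix (Fin k) (Fin N) ℝ →ₗ[ℝ] Matrix (Fin N) (Fin N) ℝ where
  toFun W := U * W
  map_add' := Matrix.mul_add U
  map_smul' c W := Matrix.mul_smul U c W

/-- A numerical constant relating the number of measurements to the admissible rank. -/
def measurementConst : ℕ := 140

theorem measurementConst_spec {N k m : ℕ} (hN : 1 ≤ N) (hk : 1 ≤ k)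
    (hm : measurementConst * N * k ≤ m) :
    (((257 ^ N) ^ k * 257 ^ (k * N) : ℕ) : ℝ) * (2 * (10 / 11) ^ m) < 1 := by
  have h1 : ((10 : ℝ) / 11) ^ m ≤ ((10 / 11) ^ measurementConst) ^ (N * k) := by
    rw [← pow_mul]
    exact pow_le_pow_of_le_one (by norm_num) (by norm_num) (by rwa [← mul_assoc])
  have h2 : (257 : ℝ) ^ 2 * (10 / 11) ^ measurementConst ≤ 1 / 4 := by
    norm_num [measurementConst]
  have h3 : (((257 ^ N) ^ k * 257 ^ (k * N) : ℕ) : ℝ) = (257 ^ 2) ^ (N * k) := by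
    push_cast
    rw [← pow_mul, mul_comm k N, ← pow_add, ← pow_mul]
    congr 1
    ring
  have h4 : (((257 : ℝ) ^ 2) * (10 / 11) ^ measurementConst) ^ (N * k) ≤ 1 / 4 := by
    refine (pow_le_pow_left₀ (by positivity) h2 _).trans ?_
    refine (pow_le_pow_of_le_one (by norm_num) (by norm_num)
      (Nat.mul_pos hN hk : 1 ≤ N * k)).trans (by norm_num)
  rw [mul_pow] at h4
  rw [h3]
  have h5 : (0 : ℝ) ≤ (257 ^ 2) ^ (N * k) := by positivity
  nlinarith [mul_le_mul_of_nonneg_left h1 h5]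

/-- Linear measurements satisfying a restricted isometry property on matrices of rank at most
`k`, written as `B * W` with orthonormal rows of `W`. -/
theorem exists_restricted_isometry {N k m : ℕ} (hN : 1 ≤ N) (hk : 1 ≤ k)
    (hm : measurementConst * N * k ≤ m) :
    ∃ A : Matrix (Fin N) (Fin N) ℝ →ₗ[ℝ] EuclideanSpace ℝ (Fin m),
      ∀ (B : Matrix (Fin N) (Fin k) ℝ) (W : Matrix (Fin k) (Fin N) ℝ), W * Wᵀ = 1 →
        √m / 8 * ‖B * W‖ ≤ ‖A (B * W)‖ ∧ ‖A (B * W)‖ ≤ 8 * √m * ‖B * W‖ := by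
  classical
  obtain ⟨s, hs, hsnet⟩ := exists_relative_net (E := EuclideanSpace ℝ (Fin N))
  rw [finrank_euclideanSpace, Fintype.card_fin] at hs
  let U : (Fin k → EuclideanSpace ℝ (Fin N)) → Matrix (Fin N) (Fin k) ℝ :=
    fun u => of fun i j => u j i
  have hnet := fun u : Fin k → EuclideanSpace ℝ (Fin N) =>
    exists_relative_net (E := LinearMap.range (mulLeftLin (U u)))
  choose t ht htnet using hnet
  have hrank : ∀ u, finrank ℝ (LinearMap.range (mulLeftLin (U u))) ≤ k * N := fun u => by
    refine (LinearMap.finrank_range_le _).trans ?_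
    simp [finrank_matrix]
  let unc : Matrix (Fin N) (Fin N) ℝ ≃ₗ[ℝ] (Fin N × Fin N → ℝ) :=
    (LinearEquiv.curry ℝ ℝ (Fin N) (Fin N)).symm
  let T : Finset (Fin N × Fin N → ℝ) :=
    (Fintype.piFinset fun _ : Fin k => s).biUnion fun u =>
      (t u).image fun y : LinearMap.range (mulLeftLin (U u)) => unc y
  have hT : T.card ≤ (257 ^ N) ^ k * 257 ^ (k * N) := by
    refine (Finset.card_biUnion_le_card_mul _ _ (257 ^ (k * N)) fun u _ => ?_).trans
      (Nat.mul_le_mul_right _ ?_)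
    · exact Finset.card_image_le.trans ((ht u).trans (Nat.pow_le_pow_right (by norm_num) (hrank u)))
    · rw [Fintype.card_piFinset_const]
      exact Nat.pow_le_pow_left hs k
  obtain ⟨A₀, hA₀⟩ := exists_linearMap_norm_bounds m T (lt_of_le_of_lt
    (mul_le_mul_of_nonneg_right (Nat.cast_le.mpr hT) (by positivity))
    (measurementConst_spec hN hk hm))
  have hm0 : 0 < √(m : ℝ) := Real.sqrt_pos.mpr (Nat.cast_pos.mpr (lt_of_lt_of_le
    (by unfold measurementConst; positivity) hm))
  have hsq : √(m : ℝ) ^ 2 = m := Real.sq_sqrt (Nat.cast_nonneg m)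
  let A := A₀ ∘ₗ unc.toLinearMap
  have hA : ∀ u ∈ Fintype.piFinset fun _ : Fin k => s, ∀ y ∈ t u,
      √m / 2 * ‖(y : Matrix (Fin N) (Fin N) ℝ)‖ ≤ ‖A y‖ ∧
        ‖A y‖ ≤ 2 * √m * ‖(y : Matrix (Fin N) (Fin N) ℝ)‖ := by
    intro u hu y hy
    have h := hA₀ (unc y) (Finset.mem_biUnion.mpr ⟨u, hu, Finset.mem_image_of_mem _ hy⟩)
    have h1 : ∑ j, unc y j ^ 2 = ‖(y : Matrix (Fin N) (Fin N) ℝ)‖ ^ 2 := by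
      rw [frobenius_norm_sq, Fintype.sum_prod_type]
      rfl
    rw [h1] at h
    constructor
    · refine le_of_sq_le_sq ?_ (norm_nonneg _)
      rw [mul_pow, div_pow, hsq]
      exact le_trans (le_of_eq (by norm_num)) h.1
    · refine le_of_sq_le_sq ?_ (by positivity)
      rw [mul_pow, mul_pow, hsq]
      exact h.2.trans (le_of_eq (by norm_num))
  have hrange : ∀ u ∈ Fintype.piFinset fun _ : Fin k => s,
      ∀ z ∈ (LinearMap.range (mulLeftLin (U u)) : Set (Matrix (Fin N) (Fin N) ℝ)),
      √m / 4 * ‖z‖ ≤ ‖A z‖ ∧ ‖A z‖ ≤ 4 * √m * ‖z‖ := by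
    intro u hu z hz
    have h := norm_bounds_of_approximation A (a := √m / 2) (b := 2 * √m) (ε := 1 / 128)
      (K := (LinearMap.range (mulLeftLin (U u)) : Set (Matrix (Fin N) (Fin N) ℝ)))
      (G := {y | √m / 2 * ‖y‖ ≤ ‖A y‖ ∧ ‖A y‖ ≤ 2 * √m * ‖y‖})
      (by linarith) (by norm_num) (by linarith) (by linarith) (fun y hy => hy) ?_ hz
    · exact ⟨le_trans (le_of_eq (by ring)) h.1, h.2.trans (le_of_eq (by ring))⟩
    · intro z hz
      obtain ⟨y, hy, hzy⟩ := htnet u ⟨z, hz⟩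
      have hAy := hA u hu y hy
      refine ⟨‖z‖ • (y : Matrix (Fin N) (Fin N) ℝ), ?_,
        Submodule.sub_mem _ hz (Submodule.smul_mem _ _ y.2), hzy⟩
      simp only [Set.mem_ofPred_eq, map_smul, norm_smul, norm_norm]
      constructor
      · nlinarith [mul_le_mul_of_nonneg_left hAy.1 (norm_nonneg z)]
      · nlinarith [mul_le_mul_of_nonneg_left hAy.2 (norm_nonneg z)]
  refine ⟨A, fun B W hW => ?_⟩
  have h := norm_bounds_of_approximation A (a := √m / 4) (b := 4 * √m) (ε := 1 / 128)
    (K := {z | ∃ B : Matrix (Fin N) (Fin k) ℝ, z = B * W})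
    (G := {y | √m / 4 * ‖y‖ ≤ ‖A y‖ ∧ ‖A y‖ ≤ 4 * √m * ‖y‖})
    (by linarith) (by norm_num) (by linarith) (by linarith) (fun y hy => hy) ?_ ⟨B, rfl⟩
  · exact ⟨le_trans (le_of_eq (by ring)) h.1, h.2.trans (le_of_eq (by ring))⟩
  · rintro _ ⟨B, rfl⟩
    choose u hu hBu using fun j => hsnet (WithLp.toLp 2 (Bᵀ j))
    let D : Matrix (Fin k) (Fin k) ℝ := diagonal fun j => ‖WithLp.toLp 2 (Bᵀ j)‖
    have hdiff : B * W - U u * (D * W) = (B - U u * D) * W := by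
      rw [Matrix.sub_mul, Matrix.mul_assoc]
    refine ⟨U u * (D * W), hrange u (Fintype.mem_piFinset.mpr hu) _ ⟨D * W, rfl⟩,
      ⟨B - U u * D, hdiff⟩, ?_⟩
    rw [hdiff, frobenius_norm_mul_of_mul_transpose_eq_one _ hW,
      frobenius_norm_mul_of_mul_transpose_eq_one _ hW]
    refine le_of_sq_le_sq ?_ (by positivity)
    rw [mul_pow, frobenius_norm_sq_eq_sum_columns, frobenius_norm_sq_eq_sum_columns,
      Finset.mul_sum]
    refine Finset.sum_le_sum fun j _ => ?_
    rw [← mul_pow]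
    refine pow_le_pow_left₀ (norm_nonneg _) (le_trans (le_of_eq ?_) (hBu j)) 2
    congr 1
    ext i
    simp [U, D, mul_comm]

end LowRank

section NullSpace

open Matrix

attribute [local instance] Matrix.frobeniusNormedAddCommGroup Matrix.frobeniusNormedSpace

theorem exists_top_subset {ι : Type*} [DecidableEq ι] (σ : ι → ℝ) (T : Finset ι) (k : ℕ)
    (hk : k ≤ T.card) :
    ∃ S ⊆ T, S.card = k ∧ ∀ i ∈ S, ∀ j ∈ T \ S, σ j ≤ σ i := by
  induction k with
  | zero => exact ⟨∅, by simp⟩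
  | succ k ih =>
    obtain ⟨S, hS, hc, hσ⟩ := ih (by omega)
    have hne : (T \ S).Nonempty := by
      rw [← Finset.card_pos, Finset.card_sdiff_of_subset hS]
      omega
    obtain ⟨a, ha, hmax⟩ := Finset.exists_max_image (T \ S) σ hne
    rw [Finset.mem_sdiff] at ha
    refine ⟨insert a S, Finset.insert_subset ha.1 hS,
      by rw [Finset.card_insert_of_notMem ha.2, hc], fun i hi j hj => ?_⟩
    have hj' : j ∈ T \ S := by
      simp only [Finset.mem_sdiff, Finset.mem_insert, not_or] at hj ⊢
      exact ⟨hj.1, hj.2.2⟩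
    rcases Finset.mem_insert.mp hi with rfl | hi
    · exact hmax j hj'
    · exact hσ i hi j hj'

theorem le_average_of_forall_le {ι : Type*} {σ : ι → ℝ} {S : Finset ι} {x : ℝ}
    (h : ∀ i ∈ S, x ≤ σ i) (hS : 0 < S.card) : x ≤ (∑ i ∈ S, σ i) / S.card := by
  rw [le_div_iff₀ (Nat.cast_pos.mpr hS), mul_comm, ← nsmul_eq_mul]
  exact Finset.card_nsmul_le_sum S σ x h

variable {N k : ℕ} {V Z : Matrix (Fin N) (Fin N) ℝ}

/-- The part of `Z` carried by the columns of `V` with index in `T`. -/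
noncomputable def spectralPart (V Z : Matrix (Fin N) (Fin N) ℝ) (T : Finset (Fin N)) :
    Matrix (Fin N) (Fin N) ℝ :=
  Z * diagIn V (fun i => if i ∈ T then 1 else 0)

theorem spectralPart_union {S T : Finset (Fin N)} (h : Disjoint S T) :
    spectralPart V Z (S ∪ T) = spectralPart V Z S + spectralPart V Z T := by
  rw [spectralPart, spectralPart, spectralPart, ← Matrix.mul_add, diagIn_add]
  congr 2
  ext i
  have hi : i ∈ S → i ∉ T := fun hiS => Finset.disjoint_left.mp h hiS
  by_cases h1 : i ∈ S <;> by_cases h2 : i ∈ T <;> simp_all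

theorem norm_spectralPart_sq (hV : Vᵀ * V = 1)
    (hZ : Zᵀ * Z = diagIn V (fun i => singVals Z i ^ 2)) (T : Finset (Fin N)) :
    ‖spectralPart V Z T‖ ^ 2 = ∑ i ∈ T, singVals Z i ^ 2 := by
  rw [frobenius_norm_sq_eq_trace, trace_mul_comm, spectralPart, gram_mul_diagIn hV hZ,
    trace_diagIn hV]
  simp

theorem exists_spectralPart_eq_mul (hV : Vᵀ * V = 1) (hk : k ≤ N) {T : Finset (Fin N)}
    (hT : T.card ≤ k) :
    ∃ (B : Matrix (Fin N) (Fin k) ℝ) (W : Matrix (Fin k) (Fin N) ℝ), W * Wᵀ = 1 ∧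
      spectralPart V Z T = B * W := by
  obtain ⟨S, hTS, hS⟩ := Finset.exists_superset_card_eq hT (by simpa using hk)
  let e : Fin k ≃ S := (S.equivFinOfCardEq hS).symm
  let W : Matrix (Fin k) (Fin N) ℝ := of fun i j => V j (e i)
  have hW : W * Wᵀ = 1 := by
    ext i j
    have h := congrFun (congrFun hV (e i)) (e j)
    simp only [mul_apply, transpose_apply] at h
    simp only [W, mul_apply, transpose_apply, of_apply]
    rw [h]
    simp [one_apply, Subtype.ext_iff.symm]
  have hW' : Wᵀ * W = diagIn V (fun i => if i ∈ S then 1 else 0) := by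
    ext a b
    have h1 : (Wᵀ * W) a b = ∑ l ∈ S, V a l * V b l := by
      simp only [W, mul_apply, transpose_apply, of_apply]
      rw [Equiv.sum_comp e fun l : S => V a l * V b l,
        Finset.sum_coe_sort S fun l => V a l * V b l]
    rw [h1, diagIn, mul_apply]
    simp [mul_diagonal, Finset.sum_ite_mem]
  refine ⟨spectralPart V Z T * Wᵀ, W, hW, ?_⟩
  rw [Matrix.mul_assoc, hW', spectralPart, Matrix.mul_assoc, diagIn_mul hV]
  congr 2
  ext i
  by_cases h : i ∈ T
  · simp [h, hTS h]
  · simp [h]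

theorem norm_map_spectralPart_le {F : Type*} [NormedAddCommGroup F] [NormedSpace ℝ F]
    (A : Matrix (Fin N) (Fin N) ℝ →ₗ[ℝ] F) {β : ℝ} (hβ : 0 ≤ β) (hk1 : 1 ≤ k) (hk : k ≤ N)
    (hA : ∀ (B : Matrix (Fin N) (Fin k) ℝ) (W : Matrix (Fin k) (Fin N) ℝ), W * Wᵀ = 1 →
      ‖A (B * W)‖ ≤ β * ‖B * W‖)
    (hV : Vᵀ * V = 1) (hZ : Zᵀ * Z = diagIn V (fun i => singVals Z i ^ 2)) (n : ℕ)
    (T : Finset (Fin N)) (hn : T.card ≤ n) (M : ℝ) (hM0 : 0 ≤ M)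
    (hM : ∀ i ∈ T, singVals Z i ≤ M) :
    ‖A (spectralPart V Z T)‖ ≤ β * (√k * M + (∑ i ∈ T, singVals Z i) / √k) := by
  have hk0 : 0 < √(k : ℝ) := Real.sqrt_pos.mpr (Nat.cast_pos.mpr hk1)
  have hsmall : ∀ (T : Finset (Fin N)) (M : ℝ), 0 ≤ M → T.card ≤ k → (∀ i ∈ T, singVals Z i ≤ M) →
      ‖A (spectralPart V Z T)‖ ≤ β * (√k * M) := by
    intro T M hM0 hT hM
    obtain ⟨B, W, hW, hBW⟩ := exists_spectralPart_eq_mul (Z := Z) hV hk hT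
    have h1 := hA B W hW
    rw [← hBW] at h1
    refine h1.trans (mul_le_mul_of_nonneg_left ?_ hβ)
    refine le_of_sq_le_sq ?_ (by positivity)
    rw [norm_spectralPart_sq hV hZ, mul_pow, Real.sq_sqrt (Nat.cast_nonneg k)]
    calc ∑ i ∈ T, singVals Z i ^ 2 ≤ ∑ i ∈ T, M ^ 2 :=
          Finset.sum_le_sum fun i hi => pow_le_pow_left₀ (singVals_nonneg _ _) (hM i hi) 2
      _ = T.card * M ^ 2 := by rw [Finset.sum_const, nsmul_eq_mul]
      _ ≤ k * M ^ 2 := by gcongr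
  induction n generalizing T M with
  | zero =>
    have : T = ∅ := Finset.card_eq_zero.mp (by omega)
    subst this
    have h := hsmall ∅ M hM0 (by simp) hM
    simpa using h
  | succ n ih =>
    rcases le_or_gt T.card k with hT | hT
    · refine (hsmall T M hM0 hT hM).trans (mul_le_mul_of_nonneg_left ?_ hβ)
      have : 0 ≤ (∑ i ∈ T, singVals Z i) / √k :=
        div_nonneg (Finset.sum_nonneg fun i _ => singVals_nonneg _ _) hk0.le
      linarith
    · obtain ⟨S, hST, hS, hσ⟩ := exists_top_subset (singVals Z) T k hT.le
      have hM' : ∀ j ∈ T \ S, singVals Z j ≤ (∑ i ∈ S, singVals Z i) / k := fun j hj => by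
        have := le_average_of_forall_le (fun i hi => hσ i hi j hj) (by omega)
        rwa [hS] at this
      have hS0 : 0 ≤ ∑ i ∈ S, singVals Z i := Finset.sum_nonneg fun i _ => singVals_nonneg _ _
      have h1 := hsmall S M hM0 hS.le fun i hi => hM i (hST hi)
      have hM0' : 0 ≤ (∑ i ∈ S, singVals Z i) / k := by positivity
      have hcard : (T \ S).card ≤ n := by
        rw [Finset.card_sdiff_of_subset hST]
        omega
      have h2 := ih (T \ S) hcard _ hM0' hM'
      have h3 : spectralPart V Z T = spectralPart V Z S + spectralPart V Z (T \ S) := by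
        rw [← spectralPart_union Finset.disjoint_sdiff, Finset.union_sdiff_of_subset hST]
      rw [h3, map_add, ← Finset.sum_sdiff hST]
      refine (norm_add_le _ _).trans ((add_le_add h1 h2).trans (le_of_eq ?_))
      have h4 : √(k : ℝ) * ((∑ i ∈ S, singVals Z i) / k) = (∑ i ∈ S, singVals Z i) / √k := by
        rw [mul_div_left_comm, Real.sqrt_div_self, div_eq_mul_inv]
      rw [h4]
      ring

/-- The null space property: elements of the kernel of suitable measurements have a Frobenius
norm much smaller than their nuclear norm. -/
theorem exists_null_space_property {m : ℕ} (hN : 1 ≤ N) (hk1 : 1 ≤ k) (hk : k ≤ N)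
    (hm : measurementConst * N * k ≤ m) :
    ∃ A : Matrix (Fin N) (Fin N) ℝ →ₗ[ℝ] EuclideanSpace ℝ (Fin m), ∀ Z, A Z = 0 →
      ∑ i, singVals Z i ^ 2 ≤ 65 ^ 2 / k * (∑ i, singVals Z i) ^ 2 := by
  obtain ⟨A, hA⟩ := exists_restricted_isometry hN hk1 hm
  have hk0 : 0 < √(k : ℝ) := Real.sqrt_pos.mpr (Nat.cast_pos.mpr hk1)
  have hm0 : 0 < √(m : ℝ) := Real.sqrt_pos.mpr (Nat.cast_pos.mpr (lt_of_lt_of_le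
    (by unfold measurementConst; positivity) hm))
  refine ⟨A, fun Z hZA => ?_⟩
  obtain ⟨V, hV, hZ⟩ := exists_transpose_mul_self_eq_diagIn Z
  obtain ⟨S, hST, hS, hσ⟩ := exists_top_subset (singVals Z) Finset.univ k (by simpa using hk)
  have hM : ∀ j ∈ Finset.univ \ S, singVals Z j ≤ (∑ i ∈ S, singVals Z i) / k := fun j hj => by
    have := le_average_of_forall_le (fun i hi => hσ i hi j hj) (by omega)
    rwa [hS] at this
  have hS0 : 0 ≤ ∑ i ∈ S, singVals Z i := Finset.sum_nonneg fun i _ => singVals_nonneg _ _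
  have hR0 : 0 ≤ ∑ i ∈ Finset.univ \ S, singVals Z i :=
    Finset.sum_nonneg fun i _ => singVals_nonneg _ _
  have hsum : ∑ i ∈ Finset.univ \ S, singVals Z i + ∑ i ∈ S, singVals Z i = ∑ i, singVals Z i :=
    Finset.sum_sdiff hST
  have hrest := norm_map_spectralPart_le A (β := 8 * √m) (by positivity) hk1 hk
    (fun B W hW => (hA B W hW).2) hV hZ N (Finset.univ \ S)
    ((Finset.card_le_univ _).trans (by simp)) _ (by positivity) hM
  obtain ⟨B, W, hW, hBW⟩ := exists_spectralPart_eq_mul (Z := Z) hV hk hS.le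
  have htop := (hA B W hW).1
  rw [← hBW] at htop
  have hZs : Z = spectralPart V Z S + spectralPart V Z (Finset.univ \ S) := by
    rw [← spectralPart_union Finset.disjoint_sdiff, Finset.union_sdiff_of_subset hST,
      spectralPart]
    simp only [Finset.mem_univ, if_true]
    rw [diagIn_one hV, Matrix.mul_one]
  have hAS : ‖A (spectralPart V Z S)‖ = ‖A (spectralPart V Z (Finset.univ \ S))‖ := by
    have : A (spectralPart V Z S) + A (spectralPart V Z (Finset.univ \ S)) = 0 := by
      rw [← map_add, ← hZs, hZA]
    rw [eq_neg_of_add_eq_zero_left this, norm_neg]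
  have h4 : √(k : ℝ) * ((∑ i ∈ S, singVals Z i) / k) = (∑ i ∈ S, singVals Z i) / √k := by
    rw [mul_div_left_comm, Real.sqrt_div_self, div_eq_mul_inv]
  have h5 : ‖spectralPart V Z S‖ ≤ 64 * ((∑ i, singVals Z i) / √k) := by
    rw [hAS] at htop
    rw [h4, ← add_div, add_comm, hsum] at hrest
    have h6 := htop.trans hrest
    refine le_of_mul_le_mul_left ?_ hm0
    linarith
  have h6 : ‖spectralPart V Z (Finset.univ \ S)‖ ≤ (∑ i, singVals Z i) / √k := by
    refine le_of_sq_le_sq ?_ (div_nonneg (by linarith) hk0.le)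
    rw [norm_spectralPart_sq hV hZ, div_pow, Real.sq_sqrt (Nat.cast_nonneg k), ← hsum]
    calc ∑ i ∈ Finset.univ \ S, singVals Z i ^ 2
        ≤ ∑ i ∈ Finset.univ \ S, (∑ i ∈ S, singVals Z i) / k * singVals Z i :=
          Finset.sum_le_sum fun i hi => by
            rw [pow_two]
            exact mul_le_mul_of_nonneg_right (hM i hi) (singVals_nonneg _ _)
      _ = (∑ i ∈ S, singVals Z i) * (∑ i ∈ Finset.univ \ S, singVals Z i) / k := by
          rw [← Finset.mul_sum]
          ring
      _ ≤ _ := by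
          gcongr
          nlinarith
  have h7 : ‖Z‖ ≤ 65 * ((∑ i, singVals Z i) / √k) := by
    have := norm_add_le (spectralPart V Z S) (spectralPart V Z (Finset.univ \ S))
    rw [← hZs] at this
    linarith
  have h8 := pow_le_pow_left₀ (norm_nonneg _) h7 2
  rw [frobenius_norm_sq_eq_trace, trace_mul_comm, ← sum_sq_singVals, mul_pow, div_pow,
    Real.sq_sqrt (Nat.cast_nonneg k)] at h8
  exact h8.trans (le_of_eq (by ring))

end NullSpace

section WeakBall

open Matrix Finset

variable {N : ℕ}

theorem card_lt_of_weakSchattenNorm_le_one {p : ℝ} (hp : 0 < p) {X : Matrix (Fin N) (Fin N) ℝ}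
    (hX : weakSchattenNorm p X ≤ 1) {τ : ℝ} (hτ : 0 < τ)
    (hne : (univ.filter fun i => τ < singVals X i).Nonempty) :
    (#{i | τ < singVals X i} : ℝ) < τ ^ (-p) := by
  let π : Equiv.Perm (Fin N) := Fin.revPerm.trans (Tuple.sort (singVals X))
  have hsorted : ∀ k, sortedSingVals X k = singVals X (π k) := fun k => rfl
  have hcard : #{i | τ < singVals X i} = #{k | τ < sortedSingVals X k} := by
    refine (card_bij (fun k _ => π k) ?_ ?_ ?_).symm
    · intro k hk
      simpa [hsorted] using hk
    · intro a _ b _ h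
      exact π.injective h
    · intro i hi
      exact ⟨π.symm i, by simpa [hsorted] using hi, by simp⟩
  obtain ⟨k, hk, hck⟩ : ∃ k, τ < sortedSingVals X k ∧ #{i | τ < singVals X i} ≤ k.val + 1 := by
    by_contra! hcon
    have hpos := card_pos.mpr hne
    have hsub : ({k | τ < sortedSingVals X k} : Finset (Fin N)).map Fin.valEmbedding ⊆
        range (#{i | τ < singVals X i} - 1) := by
      intro j hj
      obtain ⟨k, hk, rfl⟩ := mem_map.mp hj
      have := hcon k (by simpa using hk)
      simp only [Fin.valEmbedding_apply, mem_range]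
      omega
    have := card_le_card hsub
    rw [card_map, ← hcard, card_range] at this
    omega
  have hweak : ((k : ℝ) + 1) ^ (1 / p) * sortedSingVals X k ≤ 1 :=
    (le_ciSup (f := fun k : Fin N => ((k : ℝ) + 1) ^ (1 / p) * sortedSingVals X k)
      (Set.finite_range _).bddAbove k).trans hX
  have hk1 : (0 : ℝ) < (k : ℝ) + 1 := by positivity
  have hlt : ((k : ℝ) + 1) ^ (1 / p) < τ⁻¹ := by
    rw [← one_div, lt_div_iff₀ hτ]
    exact lt_of_lt_of_le (mul_lt_mul_of_pos_left hk (Real.rpow_pos_of_pos hk1 _)) hweak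
  have hpow := Real.rpow_lt_rpow (by positivity) hlt hp
  rw [← Real.rpow_mul hk1.le, one_div_mul_cancel hp.ne', Real.rpow_one, Real.inv_rpow hτ.le,
    ← Real.rpow_neg hτ.le] at hpow
  exact lt_of_le_of_lt (by exact_mod_cast hck) hpow

theorem card_le_of_weakSchattenNorm_le_one {p : ℝ} (hp : 0 < p) {X : Matrix (Fin N) (Fin N) ℝ}
    (hX : weakSchattenNorm p X ≤ 1) {τ : ℝ} (hτ : 0 < τ) :
    (#{i | τ < singVals X i} : ℝ) ≤ τ ^ (-p) := by
  rcases (univ.filter fun i => τ < singVals X i).eq_empty_or_nonempty with h | h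
  · rw [h, card_empty, Nat.cast_zero]
    positivity
  · exact (card_lt_of_weakSchattenNorm_le_one hp hX hτ h).le

theorem singVals_le_one_of_weakSchattenNorm_le_one {p : ℝ} (hp : 0 < p)
    {X : Matrix (Fin N) (Fin N) ℝ} (hX : weakSchattenNorm p X ≤ 1) (i : Fin N) :
    singVals X i ≤ 1 := by
  by_contra! h
  have hi : i ∈ univ.filter fun i => 1 < singVals X i := by simpa using h
  have := card_lt_of_weakSchattenNorm_le_one hp hX one_pos ⟨i, hi⟩
  rw [Real.one_rpow] at this
  have h1 : 1 ≤ #{i | 1 < singVals X i} := card_pos.mpr ⟨i, hi⟩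
  have h2 : (1 : ℝ) ≤ #{i | 1 < singVals X i} := by exact_mod_cast h1
  linarith

/-- A constant in the tail estimate for sequences in a weak `ℓ_p` ball. -/
noncomputable def tailConst (p s : ℝ) : ℝ := 2 ^ p / (1 - 2⁻¹ ^ (s - p))

theorem tailConst_pos {p s : ℝ} (hps : p < s) : 0 < tailConst p s := by
  have : (2⁻¹ : ℝ) ^ (s - p) < 1 := Real.rpow_lt_one (by norm_num) (by norm_num) (by linarith)
  exact div_pos (by positivity) (by linarith)

theorem tailConst_eq {p s : ℝ} (hps : p < s) :
    tailConst p s * 2⁻¹ ^ (s - p) + 2 ^ p = tailConst p s := by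
  have : (2⁻¹ : ℝ) ^ (s - p) < 1 := Real.rpow_lt_one (by norm_num) (by norm_num) (by linarith)
  rw [tailConst]
  generalize (2⁻¹ : ℝ) ^ (s - p) = x at this
  have h : 1 - x ≠ 0 := by linarith
  field_simp
  ring

/-- Tail estimate for the singular values of a matrix in the weak Schatten ball. -/
theorem sum_tail_le {p s : ℝ} (hp : 0 < p) (hps : p < s) {X : Matrix (Fin N) (Fin N) ℝ}
    (hX : weakSchattenNorm p X ≤ 1) {τ : ℝ} (hτ : 0 < τ) :
    ∑ i with singVals X i ≤ τ, singVals X i ^ s ≤ tailConst p s * τ ^ (s - p) := by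
  have hs : 0 < s := hp.trans hps
  have hcrude : ∀ τ : ℝ, 0 < τ → ∑ i with singVals X i ≤ τ, singVals X i ^ s ≤ N * τ ^ s := by
    intro τ hτ
    calc ∑ i with singVals X i ≤ τ, singVals X i ^ s ≤ ∑ i with singVals X i ≤ τ, τ ^ s :=
          sum_le_sum fun i hi =>
            Real.rpow_le_rpow (singVals_nonneg _ _) (mem_filter.mp hi).2 hs.le
      _ = #{i | singVals X i ≤ τ} * τ ^ s := by rw [sum_const, nsmul_eq_mul]
      _ ≤ N * τ ^ s := by
          gcongr
          exact (card_le_univ _).trans (by simp)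
  have hstep : ∀ τ : ℝ, 0 < τ → ∑ i with singVals X i ≤ τ, singVals X i ^ s ≤
      ∑ i with singVals X i ≤ τ * 2⁻¹, singVals X i ^ s + 2 ^ p * τ ^ (s - p) := by
    intro τ hτ
    have hsub : (univ.filter fun i => singVals X i ≤ τ) =
        (univ.filter fun i => singVals X i ≤ τ * 2⁻¹) ∪
          univ.filter fun i => singVals X i ≤ τ ∧ τ * 2⁻¹ < singVals X i := by
      ext i
      simp only [mem_filter, mem_univ, true_and, mem_union]
      constructor
      · intro h
        rcases le_or_gt (singVals X i) (τ * 2⁻¹) with h1 | h1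
        · exact Or.inl h1
        · exact Or.inr ⟨h, h1⟩
      · rintro (h | h)
        · linarith
        · exact h.1
    have hdisj : Disjoint (univ.filter fun i => singVals X i ≤ τ * 2⁻¹)
        (univ.filter fun i => singVals X i ≤ τ ∧ τ * 2⁻¹ < singVals X i) := by
      refine disjoint_filter.mpr fun i _ h1 h2 => ?_
      linarith [h2.2]
    rw [hsub, sum_union hdisj]
    gcongr
    calc ∑ i with singVals X i ≤ τ ∧ τ * 2⁻¹ < singVals X i, singVals X i ^ s
        ≤ ∑ i with singVals X i ≤ τ ∧ τ * 2⁻¹ < singVals X i, τ ^ s :=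
          sum_le_sum fun i hi =>
            Real.rpow_le_rpow (singVals_nonneg _ _) (mem_filter.mp hi).2.1 hs.le
      _ = #{i | singVals X i ≤ τ ∧ τ * 2⁻¹ < singVals X i} * τ ^ s := by
          rw [sum_const, nsmul_eq_mul]
      _ ≤ (τ * 2⁻¹) ^ (-p) * τ ^ s := by
          gcongr
          refine le_trans ?_ (card_le_of_weakSchattenNorm_le_one hp hX (by positivity))
          exact_mod_cast card_le_card fun i hi => by
            simp only [mem_filter, mem_univ, true_and] at hi ⊢
            exact hi.2
      _ = 2 ^ p * τ ^ (s - p) := by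
          rw [Real.mul_rpow hτ.le (by norm_num), Real.inv_rpow (by norm_num),
            Real.rpow_neg (by norm_num : (0 : ℝ) ≤ 2), inv_inv, mul_right_comm,
            ← Real.rpow_add hτ, mul_comm]
          congr 2
          ring
  have hiter : ∀ (n : ℕ) (τ : ℝ), 0 < τ → ∑ i with singVals X i ≤ τ, singVals X i ^ s ≤
      N * (τ ^ s * (2⁻¹ ^ s) ^ n) + tailConst p s * τ ^ (s - p) := by
    intro n
    induction n with
    | zero =>
      intro τ hτ
      have := tailConst_pos hps
      have h1 : 0 ≤ tailConst p s * τ ^ (s - p) := by positivity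
      simpa using (hcrude τ hτ).trans (le_add_of_nonneg_right h1)
    | succ n ih =>
      intro τ hτ
      refine (hstep τ hτ).trans ((add_le_add_left (ih (τ * 2⁻¹) (by positivity)) _).trans
        (le_of_eq ?_))
      rw [Real.mul_rpow hτ.le (by norm_num), Real.mul_rpow hτ.le (by norm_num), pow_succ]
      have h := tailConst_eq hps
      linear_combination τ ^ (s - p) * h
  have hlim : Filter.Tendsto (fun n : ℕ => N * (τ ^ s * (2⁻¹ ^ s) ^ n) +
      tailConst p s * τ ^ (s - p)) Filter.atTop
      (nhds (N * (τ ^ s * 0) + tailConst p s * τ ^ (s - p))) :=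
    (((tendsto_pow_atTop_nhds_zero_of_lt_one (by positivity)
      (Real.rpow_lt_one (by norm_num) (by norm_num) hs)).const_mul _).const_mul _).add_const _
  rw [mul_zero, mul_zero, zero_add] at hlim
  exact ge_of_tendsto' hlim fun n => hiter n τ hτ

end WeakBall

section Cone

open Matrix Finset

variable {N : ℕ}

theorem sum_singVals_neg (B : Matrix (Fin N) (Fin N) ℝ) (φ : ℝ → ℝ) :
    ∑ i, φ (singVals (-B) i) = ∑ i, φ (singVals B i) := by
  obtain ⟨V, hV, hB⟩ := exists_transpose_mul_self_eq_diagIn B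
  rw [sum_singVals_of_gram_eq_diagIn hV hB,
    sum_singVals_of_gram_eq_diagIn (B := -B) hV (by rw [transpose_neg, neg_mul_neg, hB])]

theorem sum_sq_singVals_nonneg (B : Matrix (Fin N) (Fin N) ℝ) : 0 ≤ (Bᵀ * B).trace := by
  rw [← sum_sq_singVals]
  positivity

theorem trace_projection_mul_le {P : Matrix (Fin N) (Fin N) ℝ} (hs : Pᵀ = P) (hP : P * P = P)
    (B : Matrix (Fin N) (Fin N) ℝ) : ((P * B)ᵀ * (P * B)).trace ≤ (Bᵀ * B).trace := by
  have h := sum_sq_singVals_nonneg ((1 - P) * B)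
  have h1 : (P * B)ᵀ * (P * B) = Bᵀ * (P * B) := by
    rw [transpose_mul, hs, Matrix.mul_assoc, ← Matrix.mul_assoc P, hP]
  have h2 : ((1 - P) * B)ᵀ * ((1 - P) * B) = Bᵀ * B - Bᵀ * (P * B) := by
    have h3 : (1 - P) * ((1 - P) * B) = B - P * B := by
      simp only [Matrix.sub_mul, Matrix.mul_sub, Matrix.one_mul, ← Matrix.mul_assoc, hP]
      abel
    rw [transpose_mul, transpose_sub, transpose_one, hs, Matrix.mul_assoc, h3, Matrix.mul_sub]
  rw [h2, trace_sub] at h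
  rw [h1]
  linarith

theorem trace_mul_projection_le {P : Matrix (Fin N) (Fin N) ℝ} (hs : Pᵀ = P) (hP : P * P = P)
    (B : Matrix (Fin N) (Fin N) ℝ) : ((B * P)ᵀ * (B * P)).trace ≤ (Bᵀ * B).trace := by
  have h := trace_projection_mul_le hs hP Bᵀ
  rw [transpose_transpose, trace_mul_comm B, transpose_mul, transpose_transpose, hs,
    trace_mul_comm] at h
  rwa [transpose_mul, hs]

theorem sum_rpow_singVals_spectralPart {V X : Matrix (Fin N) (Fin N) ℝ} (hV : Vᵀ * V = 1)
    (hX : Xᵀ * X = diagIn V (fun i => singVals X i ^ 2)) (T : Finset (Fin N)) {r : ℝ}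
    (hr : 0 < r) :
    ∑ i, singVals (spectralPart V X T) i ^ r = ∑ i ∈ T, singVals X i ^ r := by
  rw [spectralPart, sum_singVals_of_gram_eq_diagIn hV (gram_mul_diagIn hV hX _) fun x => x ^ r,
    ← sum_filter_add_sum_filter_not univ (· ∈ T)]
  have h1 : ∑ i with i ∉ T, √(singVals X i ^ 2 * (if i ∈ T then 1 else 0) ^ 2) ^ r = 0 :=
    sum_eq_zero fun i hi => by simp [(mem_filter.mp hi).2, Real.zero_rpow hr.ne']
  rw [h1, add_zero, filter_mem_eq_inter, univ_inter]
  refine sum_congr rfl fun i hi => ?_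
  simp [hi, Real.sqrt_sq (singVals_nonneg X i)]

/-- If adding `H` to `X` does not increase the Schatten `r`-quasi-norm and `H` is small on
matrices of rank `κ`, then `H` is controlled by the tail of `X`. -/
theorem sum_rpow_singVals_le_tail {V X H : Matrix (Fin N) (Fin N) ℝ} (hV : Vᵀ * V = 1)
    (hX : Xᵀ * X = diagIn V (fun i => singVals X i ^ 2)) {S : Finset (Fin N)}
    (hS : ∀ i ∈ S, 0 < singVals X i) {r κ : ℝ} (hr0 : 0 < r) (hr1 : r ≤ 1) (hκ : (#S : ℝ) ≤ κ)
    (hmin : ∑ i, singVals (X + H) i ^ r ≤ ∑ i, singVals X i ^ r)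
    (hH : 2 * (κ ^ (1 - r / 2) * (Hᵀ * H).trace ^ (r / 2)) ≤ (∑ i, singVals H i ^ r) / 4) :
    ∑ i, singVals H i ^ r ≤ 4 * ∑ i ∈ Sᶜ, singVals X i ^ r := by
  let Q := diagIn V (fun i => if i ∈ S then 1 else 0)
  let g := diagIn V (fun i => if i ∈ S then (singVals X i ^ 2)⁻¹ else 0)
  let P := X * g * Xᵀ
  have hgg : g * (Xᵀ * X) = Q := by
    rw [hX, diagIn_mul hV]
    congr 1
    ext i
    by_cases h : i ∈ S
    · have := (hS i h).ne'
      simp [h, this]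
    · simp [h]
  have hQg : Q * g = g := by
    rw [diagIn_mul hV]
    congr 1
    ext i
    by_cases h : i ∈ S <;> simp [h]
  have hQs : Qᵀ = Q := diagIn_transpose _
  have hQ2 : Q * Q = Q := by
    rw [diagIn_mul hV]
    congr 1
    ext i
    by_cases h : i ∈ S <;> simp [h]
  have hPs : Pᵀ = P := by
    simp only [P, transpose_mul, transpose_transpose]
    rw [show gᵀ = g from diagIn_transpose _, Matrix.mul_assoc]
  have hPX : P * X = X * Q := by
    simp only [P]
    rw [Matrix.mul_assoc, Matrix.mul_assoc, hgg]
  have hP2 : P * P = P := by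
    calc P * P = P * X * g * Xᵀ := by simp only [P, Matrix.mul_assoc]
      _ = P := by rw [hPX, Matrix.mul_assoc X, hQg]
  have hcard : ∀ f : Fin N → ℝ, (∀ i ∉ S, f i = 0) → ((diagIn V f).rank : ℝ) ≤ κ := by
    intro f hf
    refine le_trans ?_ hκ
    exact_mod_cast (rank_diagIn_le f).trans (card_le_card fun i hi => by
      by_contra h
      exact (mem_filter.mp hi).2 (hf i h))
  have hQrank : (Q.rank : ℝ) ≤ κ := hcard _ fun i hi => by simp [hi]
  have hgrank : (g.rank : ℝ) ≤ κ := hcard _ fun i hi => by simp [hi]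
  have hPrank : (P.rank : ℝ) ≤ κ := le_trans (by
    exact_mod_cast (rank_mul_le_left _ _).trans (rank_mul_le_right _ _)) hgrank
  have hP's : (1 - P)ᵀ = 1 - P := by rw [transpose_sub, transpose_one, hPs]
  have hP'2 : (1 - P) * (1 - P) = 1 - P := by
    simp only [Matrix.sub_mul, Matrix.mul_sub, Matrix.one_mul, Matrix.mul_one, hP2]
    abel
  have hκ0 : 0 ≤ κ := (Nat.cast_nonneg _).trans hκ
  have hn1 : ∑ i, singVals (P * H) i ^ r ≤ κ ^ (1 - r / 2) * (Hᵀ * H).trace ^ (r / 2) := by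
    refine (sum_rpow_singVals_le_of_rank_le (P * H) (le_trans (by
      exact_mod_cast rank_mul_le_left _ _) hPrank) hr0 hr1).trans ?_
    refine mul_le_mul_of_nonneg_left ?_ (Real.rpow_nonneg hκ0 _)
    exact Real.rpow_le_rpow (sum_sq_singVals_nonneg _) (trace_projection_mul_le hPs hP2 H)
      (by linarith)
  have hn2 : ∑ i, singVals ((1 - P) * H * Q) i ^ r ≤
      κ ^ (1 - r / 2) * (Hᵀ * H).trace ^ (r / 2) := by
    refine (sum_rpow_singVals_le_of_rank_le ((1 - P) * H * Q) (le_trans (by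
      exact_mod_cast rank_mul_le_right _ _) hQrank) hr0 hr1).trans ?_
    refine mul_le_mul_of_nonneg_left ?_ (Real.rpow_nonneg hκ0 _)
    exact Real.rpow_le_rpow (sum_sq_singVals_nonneg _) ((trace_mul_projection_le hQs hQ2 _).trans
      (trace_projection_mul_le hP's hP'2 H)) (by linarith)
  obtain ⟨H₀, hH₀⟩ : ∃ H₀, H₀ = P * H + (1 - P) * H * Q := ⟨_, rfl⟩
  obtain ⟨H₁, hH₁⟩ : ∃ H₁, H₁ = (1 - P) * H * (1 - Q) := ⟨_, rfl⟩
  have hn0 : ∑ i, singVals H₀ i ^ r ≤ (∑ i, singVals H i ^ r) / 4 := by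
    have := sum_rpow_singVals_add_le (P * H) ((1 - P) * H * Q) hr0 hr1
    rw [hH₀]
    linarith
  have hsplit : H = H₀ + H₁ := by
    rw [hH₀, hH₁, Matrix.mul_sub, Matrix.mul_one, Matrix.sub_mul, Matrix.one_mul]
    abel
  have hXsplit : X = spectralPart V X S + spectralPart V X Sᶜ := by
    rw [← spectralPart_union disjoint_compl_right, union_compl, spectralPart]
    simp only [mem_univ, if_true]
    rw [diagIn_one hV, Matrix.mul_one]
  have hXS : spectralPart V X S = X * Q := rfl
  have ho1 : (X * Q)ᵀ * H₁ = 0 := by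
    have h1 : (X * Q)ᵀ * (1 - P) = 0 := by
      rw [← hP's, ← transpose_mul, Matrix.sub_mul, Matrix.one_mul, ← Matrix.mul_assoc, hPX,
        Matrix.mul_assoc, hQ2, sub_self, transpose_zero]
    rw [hH₁, Matrix.mul_assoc, ← Matrix.mul_assoc _ (1 - P), h1, Matrix.zero_mul]
  have ho2 : X * Q * H₁ᵀ = 0 := by
    rw [hH₁, transpose_mul, transpose_sub, transpose_one, hQs, ← Matrix.mul_assoc,
      Matrix.mul_assoc X, Matrix.mul_sub, Matrix.mul_one, hQ2, sub_self, Matrix.mul_zero,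
      Matrix.zero_mul]
  have hadd := sum_singVals_add_of_orthogonal ho1 ho2 (φ := fun x => x ^ r)
    (Real.zero_rpow hr0.ne')
  have hdecomp : X * Q + H₁ = (X + H) + (-(spectralPart V X Sᶜ) + -H₀) := by
    have h : X + H = spectralPart V X S + spectralPart V X Sᶜ + (H₀ + H₁) := by
      rw [← hXsplit, ← hsplit]
    rw [h, ← hXS]
    abel
  have ht1 := sum_rpow_singVals_add_le (X + H) (-(spectralPart V X Sᶜ) + -H₀) hr0 hr1
  have ht2 := sum_rpow_singVals_add_le (-(spectralPart V X Sᶜ)) (-H₀) hr0 hr1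
  rw [← hdecomp, hadd] at ht1
  rw [sum_singVals_neg _ fun x => x ^ r, sum_singVals_neg _ fun x => x ^ r,
    sum_rpow_singVals_spectralPart hV hX _ hr0] at ht2
  rw [← hXS, sum_rpow_singVals_spectralPart hV hX _ hr0] at ht1
  have ht3 := sum_rpow_singVals_add_le H₀ H₁ hr0 hr1
  rw [← hsplit] at ht3
  have ht4 : ∑ i ∈ S, singVals X i ^ r + ∑ i ∈ Sᶜ, singVals X i ^ r = ∑ i, singVals X i ^ r :=
    sum_add_sum_compl S _
  linarith

end Cone

section Recovery

open Matrix Finset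

theorem rpow_sum_sq_le {ι : Type*} [Fintype ι] {s : ι → ℝ} (hs : ∀ i, 0 ≤ s i) {r d : ℝ}
    (hr0 : 0 < r) (hr1 : r ≤ 1) (hd : 0 ≤ d) (h : ∑ i, s i ^ 2 ≤ d * (∑ i, s i) ^ 2) :
    (∑ i, s i ^ 2) ^ (r / 2) ≤ d ^ (1 - r / 2) * ∑ i, s i ^ r := by
  have hint := sum_rpow_le_interpolation hs hr0 hr1 (by norm_num) (by linarith)
  simp only [Real.rpow_one] at hint
  have hsum : 0 ≤ ∑ i, s i := sum_nonneg fun i _ => hs i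
  have hR : 0 ≤ ∑ i, s i ^ r := sum_nonneg fun i _ => Real.rpow_nonneg (hs i) _
  have hF : 0 ≤ ∑ i, s i ^ 2 := sum_nonneg fun i _ => sq_nonneg _
  generalize ∑ i, s i ^ 2 = F at *
  generalize ∑ i, s i ^ r = R at *
  generalize ∑ i, s i = W at *
  rcases hF.eq_or_lt with hF0 | hF0
  · rw [← hF0, Real.zero_rpow (by linarith)]
    positivity
  have h2r : 2 - r ≠ 0 := by linarith
  have hW : W ^ (2 - r) ≤ R * F ^ (1 - r) := by
    refine (Real.rpow_le_rpow hsum hint (by linarith : (0 : ℝ) ≤ 2 - r)).trans (le_of_eq ?_)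
    rw [Real.mul_rpow (by positivity) (by positivity), ← Real.rpow_mul hR, ← Real.rpow_mul hF,
      div_mul_cancel₀ _ h2r, div_mul_cancel₀ _ h2r, show (2 : ℝ) - 1 = 1 by norm_num,
      Real.rpow_one]
  have hpow : F ^ (1 - r / 2) ≤ d ^ (1 - r / 2) * W ^ (2 - r) := by
    refine (Real.rpow_le_rpow hF h (by linarith : (0 : ℝ) ≤ 1 - r / 2)).trans (le_of_eq ?_)
    rw [Real.mul_rpow hd (by positivity), ← Real.rpow_natCast, ← Real.rpow_mul hsum]
    congr 2
    push_cast
    ring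
  have hsplit : F ^ (1 - r / 2) = F ^ (r / 2) * F ^ (1 - r) := by
    rw [← Real.rpow_add hF0]
    congr 1
    ring
  refine le_of_mul_le_mul_right ?_ (Real.rpow_pos_of_pos hF0 (1 - r))
  rw [← hsplit, mul_assoc]
  exact hpow.trans (mul_le_mul_of_nonneg_left hW (Real.rpow_nonneg hd _))

theorem rpow_sum_rpow_le {ι : Type*} [Fintype ι] {s : ι → ℝ} (hs : ∀ i, 0 ≤ s i) {r q d : ℝ}
    (hr0 : 0 < r) (hr1 : r ≤ 1) (hrq : r ≤ q) (hq : q ≤ 2) (hd : 0 ≤ d)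
    (h : ∑ i, s i ^ 2 ≤ d * (∑ i, s i) ^ 2) :
    (∑ i, s i ^ q) ^ (1 / q) ≤ (∑ i, s i ^ r) ^ (1 / r) * d ^ (1 / r - 1 / q) := by
  have hint := sum_rpow_le_interpolation hs hr0 hrq hq (by linarith)
  have hsq := rpow_sum_sq_le hs hr0 hr1 hd h
  have hR : 0 ≤ ∑ i, s i ^ r := sum_nonneg fun i _ => Real.rpow_nonneg (hs i) _
  have hQ : 0 ≤ ∑ i, s i ^ q := sum_nonneg fun i _ => Real.rpow_nonneg (hs i) _
  have hF : 0 ≤ ∑ i, s i ^ 2 := sum_nonneg fun i _ => sq_nonneg _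
  generalize ∑ i, s i ^ 2 = F at *
  generalize ∑ i, s i ^ r = R at *
  generalize ∑ i, s i ^ q = Q at *
  have h2r : 0 < 2 - r := by linarith
  have hq0 : 0 < q := by linarith
  have he : 0 ≤ 2 * (q - r) / (r * (2 - r)) :=
    div_nonneg (by linarith) (by positivity)
  have hFpow : F ^ ((q - r) / (2 - r)) ≤
      d ^ (q / r - 1) * R ^ (2 * (q - r) / (r * (2 - r))) := by
    have h1 := Real.rpow_le_rpow (Real.rpow_nonneg hF _) hsq he
    rw [Real.mul_rpow (by positivity) hR, ← Real.rpow_mul hF, ← Real.rpow_mul hd] at h1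
    convert h1 using 3 <;> field_simp
  have hfinal : Q ≤ R ^ (q / r) * d ^ (q / r - 1) := by
    refine hint.trans ((mul_le_mul_of_nonneg_left hFpow (by positivity)).trans (le_of_eq ?_))
    rw [mul_left_comm, ← Real.rpow_add_of_nonneg hR (div_nonneg (by linarith) h2r.le) he, mul_comm]
    congr 2
    field_simp
    ring
  refine (Real.rpow_le_rpow hQ hfinal (by positivity : 0 ≤ 1 / q)).trans (le_of_eq ?_)
  rw [Real.mul_rpow (by positivity) (by positivity), ← Real.rpow_mul hR, ← Real.rpow_mul hd]
  congr 2 <;> field_simp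

variable {N : ℕ}

/-- Stability of Schatten `r`-minimization on the weak Schatten ball, for an error `H` in a
kernel with the null space property of order `κ`. -/
theorem schattenNorm_le_of_null_space {p r q κ : ℝ} (hp : 0 < p) (hpr : p < r) (hr1 : r ≤ 1)
    (hrq : r ≤ q) (hq : q ≤ 2) (hκ : 0 < κ) {X H : Matrix (Fin N) (Fin N) ℝ}
    (hX : weakSchattenNorm p X ≤ 1)
    (hmin : ∑ i, singVals (X + H) i ^ r ≤ ∑ i, singVals X i ^ r)
    (hH : ∑ i, singVals H i ^ 2 ≤ 64⁻¹ * κ⁻¹ * (∑ i, singVals H i) ^ 2) :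
    schattenNorm q H ≤ (4 * tailConst p r) ^ (1 / r) * κ⁻¹ ^ (1 / p - 1 / q) := by
  obtain ⟨V, hV, hXV⟩ := exists_transpose_mul_self_eq_diagIn X
  have hr0 : 0 < r := hp.trans hpr
  have hq0 : 0 < q := by linarith
  have hκ' : 0 < κ⁻¹ := inv_pos.mpr hκ
  have hτ : 0 < κ⁻¹ ^ (1 / p) := Real.rpow_pos_of_pos hκ' _
  have hτp : (κ⁻¹ ^ (1 / p)) ^ (-p) = κ := by
    rw [← Real.rpow_mul hκ'.le, show 1 / p * -p = -1 by field_simp, Real.rpow_neg_one, inv_inv]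
  have hS := card_le_of_weakSchattenNorm_le_one hp hX hτ
  rw [hτp] at hS
  have hnonneg := singVals_nonneg H
  have hsq := rpow_sum_sq_le hnonneg hr0 hr1 (by positivity) hH
  have hR : 0 ≤ ∑ i, singVals H i ^ r := sum_nonneg fun i _ => Real.rpow_nonneg (hnonneg i) _
  have hsmall : 2 * (κ ^ (1 - r / 2) * (Hᵀ * H).trace ^ (r / 2)) ≤
      (∑ i, singVals H i ^ r) / 4 := by
    rw [← sum_sq_singVals]
    have h1 : κ ^ (1 - r / 2) * (64⁻¹ * κ⁻¹) ^ (1 - r / 2) ≤ 8⁻¹ := by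
      rw [← Real.mul_rpow hκ.le (by positivity), mul_left_comm, mul_inv_cancel₀ hκ.ne', mul_one]
      calc (64⁻¹ : ℝ) ^ (1 - r / 2) ≤ 64⁻¹ ^ (1 / 2 : ℝ) :=
            Real.rpow_le_rpow_of_exponent_ge (by norm_num) (by norm_num) (by linarith)
        _ = 8⁻¹ := by
            rw [← Real.sqrt_eq_rpow, show (64⁻¹ : ℝ) = 8⁻¹ ^ 2 by norm_num,
              Real.sqrt_sq (by norm_num)]
    have h2 := mul_le_mul_of_nonneg_left hsq (Real.rpow_nonneg hκ.le (1 - r / 2))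
    rw [← mul_assoc] at h2
    have h3 := mul_le_mul_of_nonneg_right h1 hR
    linarith
  have htail := sum_rpow_singVals_le_tail hV hXV
    (S := univ.filter fun i => κ⁻¹ ^ (1 / p) < singVals X i)
    (fun i hi => hτ.trans (mem_filter.mp hi).2) hr0 hr1 hS hmin hsmall
  rw [compl_filter] at htail
  simp only [not_lt] at htail
  have hbound : ∑ i, singVals H i ^ r ≤ 4 * tailConst p r * κ⁻¹ ^ (r / p - 1) := by
    refine htail.trans ?_
    have h1 := sum_tail_le hp hpr hX hτ
    rw [← Real.rpow_mul hκ'.le, show 1 / p * (r - p) = r / p - 1 by field_simp] at h1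
    linarith
  have hT := tailConst_pos hpr
  have hexp : 0 ≤ 1 / r - 1 / q := sub_nonneg.mpr (one_div_le_one_div_of_le hr0 hrq)
  rw [schattenNorm]
  calc (∑ i, singVals H i ^ q) ^ (1 / q)
      ≤ (∑ i, singVals H i ^ r) ^ (1 / r) * (64⁻¹ * κ⁻¹) ^ (1 / r - 1 / q) :=
        rpow_sum_rpow_le hnonneg hr0 hr1 hrq hq (by positivity) hH
    _ ≤ (4 * tailConst p r * κ⁻¹ ^ (r / p - 1)) ^ (1 / r) * κ⁻¹ ^ (1 / r - 1 / q) := by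
        gcongr
        linarith
    _ = (4 * tailConst p r) ^ (1 / r) * κ⁻¹ ^ (1 / p - 1 / q) := by
        rw [Real.mul_rpow (by positivity) (by positivity), mul_assoc, ← Real.rpow_mul hκ'.le,
          ← Real.rpow_add hκ']
        congr 2
        field_simp
        ring

theorem schattenNorm_le_of_weakSchattenNorm_le_one {p q : ℝ} (hp : 0 < p) (hpq : p < q)
    {X : Matrix (Fin N) (Fin N) ℝ} (hX : weakSchattenNorm p X ≤ 1) :
    schattenNorm q X ≤ tailConst p q ^ (1 / q) := by
  have h := sum_tail_le hp hpq hX one_pos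
  rw [Real.one_rpow, mul_one,
    filter_true_of_mem fun i _ => singVals_le_one_of_weakSchattenNorm_le_one hp hX i] at h
  exact Real.rpow_le_rpow (sum_nonneg fun i _ => Real.rpow_nonneg (singVals_nonneg X i) _) h
    (one_div_nonneg.mpr (hp.trans hpq).le)

theorem sum_rpow_singVals_le_of_schattenNorm_le {r : ℝ} (hr : 0 < r)
    {X Y : Matrix (Fin N) (Fin N) ℝ} (h : schattenNorm r X ≤ schattenNorm r Y) :
    ∑ i, singVals X i ^ r ≤ ∑ i, singVals Y i ^ r :=
  (Real.rpow_le_rpow_iff (sum_nonneg fun i _ => Real.rpow_nonneg (singVals_nonneg X i) _)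
    (sum_nonneg fun i _ => Real.rpow_nonneg (singVals_nonneg Y i) _) (one_div_pos.mpr hr)).mp h

theorem eq_zero_of_schattenNorm_le_zero {r : ℝ} (hr : 0 < r) {X : Matrix (Fin N) (Fin N) ℝ}
    (h : schattenNorm r X ≤ schattenNorm r (0 : Matrix (Fin N) (Fin N) ℝ)) : X = 0 := by
  have hz : ∀ i, singVals (0 : Matrix (Fin N) (Fin N) ℝ) i = 0 := by
    have h0 := sum_sq_singVals (0 : Matrix (Fin N) (Fin N) ℝ)
    rw [Matrix.mul_zero, trace_zero] at h0
    intro i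
    exact pow_eq_zero_iff two_ne_zero |>.mp
      ((sum_eq_zero_iff_of_nonneg fun i _ => sq_nonneg _).mp h0 i (mem_univ i))
  have hsum := sum_rpow_singVals_le_of_schattenNorm_le hr h
  simp only [hz, Real.zero_rpow hr.ne', sum_const_zero] at hsum
  have hX : ∀ i, singVals X i = 0 := fun i => by
    have h1 := (sum_eq_zero_iff_of_nonneg fun i _ => Real.rpow_nonneg (singVals_nonneg X i) r).mp
      (le_antisymm hsum (sum_nonneg fun i _ => Real.rpow_nonneg (singVals_nonneg X i) _)) i
      (mem_univ i)
    exact (Real.rpow_eq_zero (singVals_nonneg X i) hr.ne').mp h1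
  have htr := sum_sq_singVals X
  simp only [hX, ne_eq, OfNat.ofNat_ne_zero, not_false_eq_true, zero_pow, sum_const_zero] at htr
  have h2 := trace_conjTranspose_mul_self_eq_zero_iff (A := X)
  rw [conjTranspose_eq_transpose_of_trivial] at h2
  exact h2.mp htr.symm

theorem exists_recovery_map_of_large {p q : ℝ} (hp0 : 0 < p) (hp1 : p < 1) (hpq : p < q)
    (hq2 : q ≤ 2) {m : ℕ} (hN : 0 < N) (hm : measurementConst * N ≤ m) (hmN : m < N ^ 2) :
    ∃ A : Matrix (Fin N) (Fin N) ℝ →ₗ[ℝ] EuclideanSpace ℝ (Fin m),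
      ∀ X : Matrix (Fin N) (Fin N) ℝ, weakSchattenNorm p X ≤ 1 →
        ∀ Xstar : Matrix (Fin N) (Fin N) ℝ, A Xstar = A X →
          schattenNorm (min 1 q) Xstar ≤ schattenNorm (min 1 q) X →
          schattenNorm q (X - Xstar) ≤ (4 * tailConst p (min 1 q)) ^ (1 / min 1 q) *
            (64 * 65 ^ 2 * (2 * measurementConst)) ^ (1 / p - 1 / q) *
              ((N : ℝ) / m) ^ (1 / p - 1 / q) := by
  have hM : 0 < measurementConst * N := Nat.mul_pos (by decide) hN
  obtain ⟨k, hk⟩ : ∃ k, k = m / (measurementConst * N) := ⟨_, rfl⟩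
  have hk1 : 1 ≤ k := hk ▸ (Nat.one_le_div_iff hM).mpr hm
  have hkm : measurementConst * N * k ≤ m := hk ▸ Nat.mul_div_le _ _
  have hmk : m < measurementConst * N * (k + 1) := hk ▸ Nat.lt_mul_div_succ m hM
  have hkN : k ≤ N := by
    by_contra! h
    have h1 : N * N ≤ measurementConst * N * k :=
      Nat.mul_le_mul (Nat.le_mul_of_pos_left N (by decide)) h.le
    rw [sq] at hmN
    omega
  obtain ⟨A, hA⟩ := exists_null_space_property hN hk1 hkN hkm
  refine ⟨A, fun X hX Xstar hstar hmin => ?_⟩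
  have hr0 : 0 < min 1 q := lt_min one_pos (hp0.trans hpq)
  have hnull := hA (Xstar - X) (by rw [map_sub, hstar, sub_self])
  have hle := sum_rpow_singVals_le_of_schattenNorm_le hr0 hmin
  have hk0 : (0 : ℝ) < k := by exact_mod_cast hk1
  have hκ : (0 : ℝ) < k / (64 * 65 ^ 2) := by positivity
  have hexp : 0 ≤ 1 / p - 1 / q := sub_nonneg.mpr (one_div_le_one_div_of_le hp0 hpq.le)
  have hmain := schattenNorm_le_of_null_space hp0 (lt_min hp1 hpq) (min_le_left 1 q)
    (min_le_right 1 q) hq2 hκ (X := X) (H := Xstar - X) hX (by rwa [add_sub_cancel])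
    (hnull.trans (le_of_eq (by congr 1; field_simp)))
  have hneg : schattenNorm q (X - Xstar) = schattenNorm q (Xstar - X) := by
    rw [schattenNorm, schattenNorm, ← neg_sub, sum_singVals_neg _ fun x => x ^ q]
  have hT := tailConst_pos (lt_min hp1 hpq)
  have hm0 : (0 : ℝ) < m := by exact_mod_cast hM.trans_le hm
  rw [hneg, mul_assoc, ← Real.mul_rpow (by positivity) (by positivity)]
  refine hmain.trans ?_
  gcongr
  rw [inv_div, mul_assoc, div_eq_mul_inv]
  gcongr
  rw [← mul_div_assoc, le_div_iff₀ hm0, inv_mul_le_iff₀ hk0]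
  have h1 : (m : ℝ) ≤ measurementConst * N * (k + 1) := by exact_mod_cast hmk.le
  have h2 : (1 : ℝ) ≤ k := by exact_mod_cast hk1
  have h3 : (0 : ℝ) ≤ measurementConst * N := by positivity
  nlinarith

end Recovery

/-- Upper bound: there is a measurement map `𝒜 : M_N → ℝ^m` such that Schatten
`r`-quasi-norm minimization (`r = min{1, q}`) recovers every matrix in the weak Schatten
`p`-ball up to error `C_{p,q} min{1, N/m}^{1/p - 1/q}` in the Schatten `q`-quasi-norm. -/
theorem recovery_upper_bound_weak_schatten_ball
    (p q : ℝ) (hp0 : 0 < p) (hp1 : p < 1) (hpq : p < q) (hq2 : q ≤ 2) :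
    ∃ C : ℝ, 0 < C ∧
      ∀ N m : ℕ, 0 < N → 1 ≤ m → m < N ^ 2 →
        ∃ A : Matrix (Fin N) (Fin N) ℝ →ₗ[ℝ] EuclideanSpace ℝ (Fin m),
          ∀ X : Matrix (Fin N) (Fin N) ℝ, weakSchattenNorm p X ≤ 1 →
            ∀ Xstar : Matrix (Fin N) (Fin N) ℝ, A Xstar = A X →
              (∀ Z : Matrix (Fin N) (Fin N) ℝ, A Z = A X →
                schattenNorm (min 1 q) Xstar ≤ schattenNorm (min 1 q) Z) →
              schattenNorm q (X - Xstar) ≤ C * (min 1 ((N : ℝ) / m)) ^ (1 / p - 1 / q) := by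
  obtain ⟨C₁, hC₁⟩ : ∃ C₁, C₁ = (4 * tailConst p (min 1 q)) ^ (1 / min 1 q) *
    (64 * 65 ^ 2 * (2 * measurementConst)) ^ (1 / p - 1 / q) := ⟨_, rfl⟩
  obtain ⟨C₂, hC₂⟩ : ∃ C₂, C₂ = tailConst p q ^ (1 / q) *
    (measurementConst : ℝ) ^ (1 / p - 1 / q) := ⟨_, rfl⟩
  have hT₁ := tailConst_pos (lt_min hp1 hpq)
  have hT₂ := tailConst_pos hpq
  have hM : (1 : ℝ) ≤ measurementConst := by norm_num [measurementConst]
  have hC₁0 : 0 < C₁ := by rw [hC₁]; positivity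
  have hC₂0 : 0 < C₂ := by rw [hC₂]; positivity
  have hexp : 0 ≤ 1 / p - 1 / q := sub_nonneg.mpr (one_div_le_one_div_of_le hp0 hpq.le)
  refine ⟨C₁ + C₂, by positivity, fun N m hN hm1 hmN => ?_⟩
  have hN0 : (0 : ℝ) < N := by exact_mod_cast hN
  have hm0 : (0 : ℝ) < m := by exact_mod_cast hm1
  rcases le_or_gt (measurementConst * N) m with hm | hm
  · obtain ⟨A, hA⟩ := exists_recovery_map_of_large hp0 hp1 hpq hq2 hN hm hmN
    refine ⟨A, fun X hX Xstar hstar hmin => (hA X hX Xstar hstar (hmin X rfl)).trans ?_⟩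
    have hm' : (measurementConst : ℝ) * N ≤ m := by exact_mod_cast hm
    have hmin1 : min 1 ((N : ℝ) / m) = N / m :=
      min_eq_right ((div_le_one hm0).mpr (by nlinarith))
    rw [hmin1, ← hC₁]
    gcongr
    linarith
  · refine ⟨0, fun X hX Xstar _ hmin => ?_⟩
    have hzero := eq_zero_of_schattenNorm_le_zero (lt_min one_pos (hp0.trans hpq)) (hmin 0 rfl)
    rw [hzero, sub_zero]
    refine (schattenNorm_le_of_weakSchattenNorm_le_one hp0 hpq hX).trans ?_
    have hm' : (m : ℝ) ≤ measurementConst * N := by exact_mod_cast hm.le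
    have hmin1 : (measurementConst : ℝ)⁻¹ ≤ min 1 ((N : ℝ) / m) := by
      refine le_min (inv_le_one_of_one_le₀ hM) ?_
      rw [le_div_iff₀ hm0, inv_mul_le_iff₀ (by linarith)]
      exact hm'
    have hpow := Real.rpow_le_rpow (by positivity) hmin1 hexp
    calc tailConst p q ^ (1 / q)
        = C₂ * (measurementConst : ℝ)⁻¹ ^ (1 / p - 1 / q) := by
          rw [hC₂, mul_assoc, ← Real.mul_rpow (by positivity) (by positivity),
            mul_inv_cancel₀ (by linarith), Real.one_rpow, mul_one]
      _ ≤ (C₁ + C₂) * min 1 ((N : ℝ) / m) ^ (1 / p - 1 / q) := by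
          gcongr
          linarith
end

section
/- Let N, m, t be positive integers, let 𝒜 : M_N → ℝ^m be a linear map, and let 0 ≤ α ≤ β satisfy α ‖Z‖_{S_2} ≤ ‖𝒜Z‖_{ℓ2} ≤ β ‖Z‖_{S_2} for every Z ∈ M_N with rank(Z) ≤ 2t. Then for all U, V ∈ M_N with rank(U) ≤ t, rank(V) ≤ t and trace(Uᵀ V) = 0, one has ⟨𝒜U, 𝒜V⟩ ≤ ((β² − α²)/2) · ‖U‖_{S_2} ‖V‖_{S_2}. -/
open scoped Matrix

theorem schattenNorm_nonneg {N : ℕ} (p : ℝ) (X : Matrix (Fin N) (Fin N) ℝ) :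
    0 ≤ schattenNorm p X :=
  Real.rpow_nonneg (Finset.sum_nonneg fun _ _ => Real.rpow_nonneg (Real.sqrt_nonneg _) _) _

theorem schattenNorm_two_sq {N : ℕ} (X : Matrix (Fin N) (Fin N) ℝ) :
    schattenNorm 2 X ^ 2 = Matrix.trace (Xᵀ * X) := by
  have hsum : ∑ i, singVals X i ^ (2 : ℝ) = Matrix.trace (Xᵀ * X) := by
    rw [← Matrix.conjTranspose_eq_transpose_of_trivial,
      (Matrix.isHermitian_conjTranspose_mul_self X).trace_eq_sum_eigenvalues]
    refine Finset.sum_congr rfl fun i _ => ?_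
    rw [Real.rpow_two]
    exact Real.sq_sqrt (Matrix.eigenvalues_conjTranspose_mul_self_nonneg X i)
  have hnonneg : 0 ≤ ∑ i, singVals X i ^ (2 : ℝ) :=
    Finset.sum_nonneg fun _ _ => Real.rpow_nonneg (Real.sqrt_nonneg _) _
  rw [schattenNorm, ← Real.sqrt_eq_rpow, Real.sq_sqrt hnonneg, hsum]

theorem schattenNorm_two_sq_add_of_orthogonal {N : ℕ} {U V : Matrix (Fin N) (Fin N) ℝ}
    (horth : Matrix.trace (Uᵀ * V) = 0) (a b : ℝ) :
    schattenNorm 2 (a • U + b • V) ^ 2 =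
      a ^ 2 * schattenNorm 2 U ^ 2 + b ^ 2 * schattenNorm 2 V ^ 2 := by
  have horth' : Matrix.trace (Vᵀ * U) = 0 := by
    rw [← Matrix.trace_transpose, Matrix.transpose_mul, Matrix.transpose_transpose, horth]
  simp only [schattenNorm_two_sq, Matrix.transpose_add, Matrix.transpose_smul, Matrix.add_mul,
    Matrix.mul_add, Matrix.smul_mul, Matrix.mul_smul, Matrix.trace_add, Matrix.trace_smul,
    smul_eq_mul, horth, horth']
  ring

theorem Matrix.rank_smul_add_smul_le {m n K : Type*} [Finite m] [Fintype n] [Field K]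
    (U V : Matrix m n K) (a b : K) : (a • U + b • V).rank ≤ U.rank + V.rank := by
  have hle : LinearMap.range (a • U + b • V).mulVecLin ≤
      LinearMap.range U.mulVecLin ⊔ LinearMap.range V.mulVecLin := by
    rintro _ ⟨x, rfl⟩
    refine Submodule.mem_sup.2 ⟨a • U *ᵥ x, ⟨a • x, by simp⟩,
      b • V *ᵥ x, ⟨b • x, by simp⟩, ?_⟩
    simp
  exact (Submodule.finrank_mono hle).trans (Submodule.finrank_add_le_finrank_add_finrank _ _)

/-- Polarization-type estimate: if `𝒜` satisfies a two-sided frame bound on matrices of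
rank at most `2t`, then for orthogonal low-rank matrices `U`, `V` the inner product
`⟨𝒜U, 𝒜V⟩` is at most `((β² - α²)/2)‖U‖_{S_2}‖V‖_{S_2}`. -/
theorem inner_bound_of_restricted_frame_bounds
    (N m t : ℕ) (hN : 0 < N) (hm : 0 < m) (ht : 0 < t)
    (A : Matrix (Fin N) (Fin N) ℝ →ₗ[ℝ] EuclideanSpace ℝ (Fin m))
    (α β : ℝ) (hα0 : 0 ≤ α) (hαβ : α ≤ β)
    (hbounds : ∀ Z : Matrix (Fin N) (Fin N) ℝ, Z.rank ≤ 2 * t →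
      α * schattenNorm 2 Z ≤ ‖A Z‖ ∧ ‖A Z‖ ≤ β * schattenNorm 2 Z)
    (U V : Matrix (Fin N) (Fin N) ℝ)
    (hU : U.rank ≤ t) (hV : V.rank ≤ t)
    (horth : Matrix.trace (Uᵀ * V) = 0) :
    (inner ℝ (A U) (A V) : ℝ) ≤
      ((β ^ 2 - α ^ 2) / 2) * schattenNorm 2 U * schattenNorm 2 V := by
  have hrank : ∀ a b : ℝ, (a • U + b • V).rank ≤ 2 * t := fun a b =>
    (Matrix.rank_smul_add_smul_le U V a b).trans (by omega)
  have hu0 := schattenNorm_nonneg 2 U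
  have hv0 := schattenNorm_nonneg 2 V
  have hUb := (hbounds U (by omega)).2
  have hVb := (hbounds V (by omega)).2
  set u := schattenNorm 2 U with hu
  set v := schattenNorm 2 V with hv
  rcases hu0.eq_or_lt with h | hupos
  · have hAU : A U = 0 := by simpa [← h] using hUb
    simp [hAU, ← h]
  rcases hv0.eq_or_lt with h | hvpos
  · have hAV : A V = 0 := by simpa [← h] using hVb
    simp [hAV, ← h]
  have hupper : ‖A (v • U + u • V)‖ ^ 2 ≤ β ^ 2 * (2 * (u * v) ^ 2) := by
    have hsq := pow_le_pow_left₀ (norm_nonneg _) (hbounds _ (hrank v u)).2 2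
    rw [mul_pow, schattenNorm_two_sq_add_of_orthogonal horth, ← hu, ← hv] at hsq
    linarith
  have hlower : α ^ 2 * (2 * (u * v) ^ 2) ≤ ‖A (v • U + (-u) • V)‖ ^ 2 := by
    have hsq := pow_le_pow_left₀ (mul_nonneg hα0 (schattenNorm_nonneg 2 _))
      (hbounds _ (hrank v (-u))).1 2
    rw [mul_pow, schattenNorm_two_sq_add_of_orthogonal horth, ← hu, ← hv] at hsq
    linarith
  simp only [map_add, map_smul, norm_add_sq_real, norm_smul, real_inner_smul_left,
    real_inner_smul_right, norm_neg] at hupper hlower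
  have huv : 0 < u * v := mul_pos hupos hvpos
  refine le_of_mul_le_mul_left ?_ huv
  linarith
end
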